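/- arXiv:2208.04922 — 10 statements merged into one kernel-verified Lean document; each statement's English description precedes it below -/
import Mathlib

section
/- Let F be the cumulative distribution function of a Borel probability measure P on [0,1] admitting a continuous, strictly positive density f on [0,1], with mean μ := ∫₀¹ t f(t) dt ∈ (0,1), and suppose F is strictly log-concave, i.e., x ↦ log F(x) is strictly concave on (0,1]. Then the function ξ(x) := x − (∫₀^x t f(t) dt)/F(x) is strictly increasing on (0,1]: for all 0 < x < y ≤ 1, ξ(x) < ξ(y). -/
open MeasureTheory Set intervalIntegral

/-- A concave function `h` has larger increments on the left: for `s < x` and `d > 0`,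
`h (x + d) - h x ≤ h (s + d) - h s`. -/
theorem ConcaveOn.add_le_add_of_shift {S : Set ℝ} {h : ℝ → ℝ} (hh : ConcaveOn ℝ S h)
    {s x d : ℝ} (hs : s ∈ S) (hxd : x + d ∈ S) (hsx : s < x) (hd : 0 < d) :
    h s + h (x + d) ≤ h (s + d) + h x := by
  have hL : 0 < x + d - s := by linarith
  have ha : 0 ≤ (x - s) / (x + d - s) := div_nonneg (by linarith) hL.le
  have hb : 0 ≤ d / (x + d - s) := div_nonneg hd.le hL.le
  have hab : (x - s) / (x + d - s) + d / (x + d - s) = 1 := by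
    field_simp
    ring
  have h₁ := hh.2 hs hxd ha hb hab
  have h₂ := hh.2 hs hxd hb ha (by rw [add_comm, hab])
  simp only [smul_eq_mul] at h₁ h₂
  have e₁ : (x - s) / (x + d - s) * s + d / (x + d - s) * (x + d) = s + d := by
    field_simp
    ring
  have e₂ : d / (x + d - s) * s + (x - s) / (x + d - s) * (x + d) = x := by
    field_simp
    ring
  rw [e₁] at h₁
  rw [e₂] at h₂
  have e₃ : h s + h (x + d) = ((x - s) / (x + d - s) + d / (x + d - s)) * h s
      + ((x - s) / (x + d - s) + d / (x + d - s)) * h (x + d) := by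
    rw [hab, one_mul, one_mul]
  linarith

/-- Integration by parts for a primitive: `∫₀ˣ t f(t) dt = x F(x) - ∫₀ˣ F`. -/
theorem integral_id_mul_eq_sub_integral_primitive {f F : ℝ → ℝ} {x : ℝ} (hx : 0 ≤ x)
    (hf : ContinuousOn f (Icc 0 x)) (hF : ∀ y, F y = ∫ t in (0 : ℝ)..y, f t) :
    (∫ t in (0 : ℝ)..x, t * f t) = x * F x - ∫ t in (0 : ℝ)..x, F t := by
  have hF' : F = fun y => ∫ t in (0 : ℝ)..y, f t := funext hF
  have hi : IntervalIntegrable f volume 0 x := hf.intervalIntegrable_of_Icc hx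
  have hFc : ContinuousOn F (uIcc 0 x) := by
    rw [hF']
    exact continuousOn_primitive_interval' hi left_mem_uIcc
  have key := integral_mul_deriv_eq_deriv_mul_of_hasDerivAt (a := 0) (b := x)
    (u := fun t : ℝ => t) (u' := fun _ => 1) (v := F) (v' := f)
    continuousOn_id hFc (fun t _ => hasDerivAt_id t)
    (fun t ht => by
      rw [min_eq_left hx, max_eq_right hx] at ht
      rw [hF']
      have hnhds : Icc 0 x ∈ nhds t := Icc_mem_nhds ht.1 ht.2
      refine integral_hasDerivAt_right ?_ ?_ (hf.continuousAt hnhds)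
      · exact (hf.mono (Icc_subset_Icc_right ht.2.le)).intervalIntegrable_of_Icc ht.1.le
      · exact (hf.mono Ioo_subset_Icc_self).stronglyMeasurableAtFilter isOpen_Ioo t ht)
    intervalIntegrable_const hi
  simpa using key

/-- If the prior cdf `F` (of a distribution on `[0,1]` with continuous,
strictly positive density `f` and mean `μ ∈ (0,1)`) is strictly log-concave on `(0,1]`,
then `ξ x = x - E[θ | θ ≤ x]` is strictly increasing on `(0,1]`. -/
theorem xi_strictMono
    (f : ℝ → ℝ)
    (hf_cont : ContinuousOn f (Icc 0 1))
    (hf_pos : ∀ t ∈ Icc (0:ℝ) 1, 0 < f t)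
    (hf_int : (∫ t in (0:ℝ)..1, f t) = 1)
    (F : ℝ → ℝ) (hF : ∀ x, F x = ∫ t in (0:ℝ)..x, f t)
    (hμ : (∫ t in (0:ℝ)..1, t * f t) ∈ Ioo (0:ℝ) 1)
    (hlog : StrictConcaveOn ℝ (Ioc (0:ℝ) 1) (fun x => Real.log (F x)))
    (ξ : ℝ → ℝ) (hξ : ∀ x, ξ x = x - (∫ t in (0:ℝ)..x, t * f t) / F x) :
    ∀ x y : ℝ, 0 < x → x < y → y ≤ 1 → ξ x < ξ y := by
  have hFpos : ∀ x ∈ Ioc (0 : ℝ) 1, 0 < F x := fun x hx => by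
    have hsub : Icc 0 x ⊆ Icc (0 : ℝ) 1 := Icc_subset_Icc_right hx.2
    rw [hF]
    exact intervalIntegral_pos_of_pos_on ((hf_cont.mono hsub).intervalIntegrable_of_Icc hx.1.le)
      (fun t ht => hf_pos t (hsub (Ioo_subset_Icc_self ht))) hx.1
  have hFcont : ContinuousOn F (Icc 0 1) := by
    rw [funext hF, ← uIcc_of_le zero_le_one]
    exact continuousOn_primitive_interval'
      (hf_cont.intervalIntegrable_of_Icc zero_le_one) left_mem_uIcc
  have hFint : ∀ a b : ℝ, 0 ≤ a → a ≤ b → b ≤ 1 → IntervalIntegrable F volume a b :=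
    fun a b ha hab hb =>
      (hFcont.mono (Icc_subset_Icc ha hb)).intervalIntegrable_of_Icc hab
  have hξF : ∀ x ∈ Ioc (0 : ℝ) 1, ξ x = (∫ t in (0 : ℝ)..x, F t) / F x := fun x hx => by
    have := (hFpos x hx).ne'
    rw [hξ, integral_id_mul_eq_sub_integral_primitive hx.1.le
      (hf_cont.mono (Icc_subset_Icc_right hx.2)) hF]
    field_simp
    ring
  intro x y hx hxy hy
  have hxm : x ∈ Ioc (0 : ℝ) 1 := ⟨hx, hxy.le.trans hy⟩
  have hym : y ∈ Ioc (0 : ℝ) 1 := ⟨hx.trans hxy, hy⟩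
  obtain ⟨d, hd, rfl⟩ : ∃ d, 0 < d ∧ y = x + d := ⟨y - x, by linarith, by ring⟩
  have hshift : ∀ s ∈ Ioo 0 x, F s * F (x + d) ≤ F (s + d) * F x := fun s hs => by
    have hsm : s ∈ Ioc (0 : ℝ) 1 := ⟨hs.1, hs.2.le.trans hxm.2⟩
    have hsdm : s + d ∈ Ioc (0 : ℝ) 1 := ⟨by linarith [hs.1], by linarith [hs.2]⟩
    have h := hlog.concaveOn.add_le_add_of_shift hsm hym hs.2 hd
    rw [← Real.log_mul (hFpos _ hsm).ne' (hFpos _ hym).ne',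
      ← Real.log_mul (hFpos _ hsdm).ne' (hFpos _ hxm).ne'] at h
    exact (Real.log_le_log_iff (mul_pos (hFpos _ hsm) (hFpos _ hym))
      (mul_pos (hFpos _ hsdm) (hFpos _ hxm))).1 h
  have hle : (∫ s in (0 : ℝ)..x, F s) * F (x + d) ≤ (∫ s in d..(x + d), F s) * F x := by
    have hsh : IntervalIntegrable (fun s => F (s + d)) volume 0 x := by
      refine ContinuousOn.intervalIntegrable_of_Icc hx.le (hFcont.comp (by fun_prop) ?_)
      intro s hs
      exact ⟨by linarith [hs.1], by linarith [hs.2]⟩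
    have hcv : (∫ s in (0 : ℝ)..x, F (s + d)) = ∫ s in d..(x + d), F s := by
      rw [integral_comp_add_right, zero_add]
    rw [← hcv, ← intervalIntegral.integral_mul_const, ← intervalIntegral.integral_mul_const]
    exact integral_mono_on_of_le_Ioo hx.le ((hFint 0 x le_rfl hx.le hxm.2).mul_const _)
      (hsh.mul_const _) hshift
  have hd1 : d ≤ 1 := by linarith
  have hpos : 0 < ∫ s in (0 : ℝ)..d, F s :=
    intervalIntegral_pos_of_pos_on (hFint 0 d le_rfl hd.le hd1)
      (fun t ht => hFpos t ⟨ht.1, ht.2.le.trans hd1⟩) hd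
  have hsplit := integral_add_adjacent_intervals (hFint 0 d le_rfl hd.le hd1)
    (hFint d (x + d) hd.le (by linarith) hy)
  rw [hξF x hxm, hξF _ hym, div_lt_div_iff₀ (hFpos _ hxm) (hFpos _ hym), ← hsplit, add_mul]
  linarith [mul_pos hpos (hFpos _ hxm)]
end

section
/- Suppose 0 < γ < 1 − μ. Then there exists a unique α* ∈ [0, 1−γ] such that α* = (∫₀^{α*+γ} t f(t) dt)/F(α*+γ); equivalently, x* := α* + γ is the unique point in (0,1) satisfying ξ(x*) = γ. Moreover this α* lies in (0, 1−γ). -/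
open MeasureTheory Set intervalIntegral

lemma intervalIntegrable_of_continuousOn_unit {g : ℝ → ℝ} (hg : ContinuousOn g (Icc 0 1)) {a b : ℝ}
    (ha : a ∈ Icc (0 : ℝ) 1) (hb : b ∈ Icc (0 : ℝ) 1) : IntervalIntegrable g volume a b :=
  (hg.mono (uIcc_subset_Icc ha hb)).intervalIntegrable

lemma continuousOn_primitive_unit {g : ℝ → ℝ} (hg : ContinuousOn g (Icc 0 1)) :
    ContinuousOn (fun x => ∫ t in (0 : ℝ)..x, g t) (Icc 0 1) := by
  have h := continuousOn_primitive_interval (μ := volume) (f := g) (a := 0) (b := 1)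
    (by rw [uIcc_of_le zero_le_one]; exact hg.integrableOn_Icc)
  rwa [uIcc_of_le zero_le_one] at h

/-- Integration by parts: `∫₀ˣ F = x F(x) - ∫₀ˣ t f(t) dt` for the primitive `F` of `f`. -/
lemma integral_primitive_eq {f F : ℝ → ℝ} (hf : ContinuousOn f (Icc 0 1))
    (hF : ∀ x, F x = ∫ t in (0 : ℝ)..x, f t) {x : ℝ} (hx : x ∈ Icc (0 : ℝ) 1) :
    ∫ t in (0 : ℝ)..x, F t = x * F x - ∫ t in (0 : ℝ)..x, t * f t := by
  have hsub : Icc 0 x ⊆ Icc (0 : ℝ) 1 := Icc_subset_Icc_right hx.2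
  have hFc : ContinuousOn F (Icc 0 1) := by
    rw [funext hF]; exact continuousOn_primitive_unit hf
  have hderiv : ∀ t ∈ Ioo (min 0 x) (max 0 x), HasDerivAt F (f t) t := by
    intro t ht
    rw [min_eq_left hx.1, max_eq_right hx.1] at ht
    have ht' : t ∈ Ioo (0 : ℝ) 1 := ⟨ht.1, ht.2.trans_le hx.2⟩
    rw [funext hF]
    refine integral_hasDerivAt_right
      (intervalIntegrable_of_continuousOn_unit hf (by simp) (Ioo_subset_Icc_self ht')) ?_
      (hf.continuousAt (Icc_mem_nhds ht'.1 ht'.2))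
    exact (hf.mono Ioo_subset_Icc_self).stronglyMeasurableAtFilter isOpen_Ioo t ht'
  have h := integral_mul_deriv_eq_deriv_mul_of_hasDerivAt (a := 0) (b := x)
    (u := fun t => t) (v := F) (u' := fun _ => 1) (v' := f) continuousOn_id
    (hFc.mono (by rwa [uIcc_of_le hx.1])) (fun t _ => hasDerivAt_id t) hderiv
    (by simp) (intervalIntegrable_of_continuousOn_unit hf (by simp) hx)
  simp only [one_mul, zero_mul, sub_zero] at h
  linarith

/-- A positive log-concave function on `(0,1]` satisfies `F(x-s) F(y) ≤ F(x) F(y-s)`. -/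
lemma mul_le_mul_of_log_concave {F : ℝ → ℝ} (hpos : ∀ x ∈ Ioc (0 : ℝ) 1, 0 < F x)
    (hlog : ConcaveOn ℝ (Ioc (0 : ℝ) 1) (fun x => Real.log (F x))) {x y s : ℝ}
    (hs : 0 ≤ s) (hsx : s < x) (hxy : x < y) (hy : y ≤ 1) :
    F (x - s) * F y ≤ F x * F (y - s) := by
  have m₁ : x - s ∈ Ioc (0 : ℝ) 1 := ⟨by linarith, by linarith⟩
  have m₂ : y ∈ Ioc (0 : ℝ) 1 := ⟨by linarith, hy⟩
  have m₃ : x ∈ Ioc (0 : ℝ) 1 := ⟨by linarith, by linarith⟩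
  have m₄ : y - s ∈ Ioc (0 : ℝ) 1 := ⟨by linarith, by linarith⟩
  have hd : 0 < y - x + s := by linarith
  have hw : (y - x) / (y - x + s) + s / (y - x + s) = 1 := by
    rw [← add_div, div_self hd.ne']
  have ha : 0 ≤ (y - x) / (y - x + s) := div_nonneg (by linarith) hd.le
  have hb : 0 ≤ s / (y - x + s) := div_nonneg hs hd.le
  have h₁ := hlog.2 m₁ m₂ ha hb hw
  have h₂ := hlog.2 m₁ m₂ hb ha (by rw [add_comm]; exact hw)
  have e₁ : (y - x) / (y - x + s) * (x - s) + s / (y - x + s) * y = x := by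
    field_simp; ring
  have e₂ : s / (y - x + s) * (x - s) + (y - x) / (y - x + s) * y = y - s := by
    field_simp; ring
  simp only [smul_eq_mul, e₁, e₂] at h₁ h₂
  have hsum : Real.log (F (x - s)) + Real.log (F y) ≤ Real.log (F x) + Real.log (F (y - s)) := by
    calc _ = ((y - x) / (y - x + s) + s / (y - x + s)) * Real.log (F (x - s))
          + ((y - x) / (y - x + s) + s / (y - x + s)) * Real.log (F y) := by
          rw [hw, one_mul, one_mul]
      _ ≤ _ := by linarith
  rw [← Real.log_mul (hpos _ m₁).ne' (hpos _ m₂).ne',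
    ← Real.log_mul (hpos _ m₃).ne' (hpos _ m₄).ne'] at hsum
  exact (Real.log_le_log_iff (mul_pos (hpos _ m₁) (hpos _ m₂))
    (mul_pos (hpos _ m₃) (hpos _ m₄))).1 hsum

/-- For a positive log-concave `F`, the ratio `(∫₀ˣ F) / F(x)` is strictly increasing. -/
lemma strictMonoOn_integral_div_of_log_concave {F : ℝ → ℝ} (hF : ContinuousOn F (Icc 0 1))
    (hpos : ∀ x ∈ Ioc (0 : ℝ) 1, 0 < F x)
    (hlog : ConcaveOn ℝ (Ioc (0 : ℝ) 1) (fun x => Real.log (F x))) :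
    StrictMonoOn (fun x => (∫ t in (0 : ℝ)..x, F t) / F x) (Ioc 0 1) := by
  intro x hx y hy hxy
  have hyx : y - x ∈ Icc (0 : ℝ) 1 := ⟨by linarith, by linarith [hx.1, hy.2]⟩
  have hyI : y ∈ Icc (0 : ℝ) 1 := Ioc_subset_Icc_self hy
  have hxI : x ∈ Icc (0 : ℝ) 1 := Ioc_subset_Icc_self hx
  have hii := fun {a b : ℝ} => intervalIntegrable_of_continuousOn_unit hF (a := a) (b := b)
  have hsplit : (∫ t in (0 : ℝ)..(y - x), F t) + ∫ t in (y - x)..y, F t = ∫ t in (0 : ℝ)..y, F t :=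
    integral_add_adjacent_intervals (hii (by simp) hyx) (hii hyx hyI)
  have hfirst : 0 < ∫ t in (0 : ℝ)..(y - x), F t :=
    intervalIntegral_pos_of_pos_on (hii (by simp) hyx)
      (fun t ht => hpos t ⟨ht.1, ht.2.le.trans hyx.2⟩) (by linarith)
  have hshift : ∫ t in (y - x)..y, F t = ∫ t in (0 : ℝ)..x, F (t + (y - x)) := by
    rw [integral_comp_add_right]; simp
  have hshift_int : IntervalIntegrable (fun t => F (t + (y - x))) volume 0 x := by
    refine (hF.comp (by fun_prop) fun t ht => ?_).intervalIntegrable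
    rw [uIcc_of_le hxI.1] at ht
    exact ⟨by linarith [ht.1], by linarith [ht.2, hy.2]⟩
  have hle : (∫ t in (0 : ℝ)..x, F t) * F y ≤ F x * ∫ t in (0 : ℝ)..x, F (t + (y - x)) := by
    rw [← intervalIntegral.integral_mul_const, ← intervalIntegral.integral_const_mul]
    refine integral_mono_on_of_le_Ioo hxI.1 ((hii (by simp) hxI).mul_const _)
      (hshift_int.const_mul _) fun t ht => ?_
    have := mul_le_mul_of_log_concave hpos hlog (s := x - t) (by linarith [ht.2])
      (by linarith [ht.1]) hxy hy.2
    rwa [show x - (x - t) = t by ring, show y - (x - t) = t + (y - x) by ring] at this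
  show _ / _ < _ / _
  rw [div_lt_div_iff₀ (hpos x hx) (hpos y hy), ← hsplit, hshift]
  nlinarith [mul_pos hfirst (hpos x hx)]

/-- For a low certification cost `0 < γ < 1 - μ`, there is a unique
`α* ∈ [0, 1-γ]` with `α* = E[θ | θ ≤ α* + γ]`; equivalently `x* = α* + γ` is the unique
point of `(0,1)` with `ξ x* = γ`.  Moreover `α*` lies in the open interval `(0, 1-γ)`. -/
theorem unique_nondisclosure_value
    (f : ℝ → ℝ)
    (hf_cont : ContinuousOn f (Icc 0 1))
    (hf_pos : ∀ t ∈ Icc (0:ℝ) 1, 0 < f t)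
    (hf_int : (∫ t in (0:ℝ)..1, f t) = 1)
    (F : ℝ → ℝ) (hF : ∀ x, F x = ∫ t in (0:ℝ)..x, f t)
    (μ : ℝ) (hμdef : μ = ∫ t in (0:ℝ)..1, t * f t) (hμ : μ ∈ Ioo (0:ℝ) 1)
    (hlog : StrictConcaveOn ℝ (Ioc (0:ℝ) 1) (fun x => Real.log (F x)))
    (ξ : ℝ → ℝ) (hξ : ∀ x, ξ x = x - (∫ t in (0:ℝ)..x, t * f t) / F x)
    (γ : ℝ) (hγ : 0 < γ) (hγ' : γ < 1 - μ) :
    ∃ α : ℝ, α ∈ Ioo (0:ℝ) (1 - γ) ∧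
      α = (∫ t in (0:ℝ)..(α + γ), t * f t) / F (α + γ) ∧
      (∀ β ∈ Icc (0:ℝ) (1 - γ),
        β = (∫ t in (0:ℝ)..(β + γ), t * f t) / F (β + γ) → β = α) ∧
      ξ (α + γ) = γ ∧
      (∀ x ∈ Ioo (0:ℝ) 1, ξ x = γ → x = α + γ) := by
  have hFpos : ∀ x ∈ Ioc (0 : ℝ) 1, 0 < F x := fun x hx => by
    rw [hF]
    exact intervalIntegral_pos_of_pos_on
      (intervalIntegrable_of_continuousOn_unit hf_cont (by simp) (Ioc_subset_Icc_self hx))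
      (fun t ht => hf_pos t ⟨ht.1.le, ht.2.le.trans hx.2⟩) hx.1
  have hFc : ContinuousOn F (Icc 0 1) := by
    rw [funext hF]; exact continuousOn_primitive_unit hf_cont
  have htf : ContinuousOn (fun t => t * f t) (Icc 0 1) := continuousOn_id.mul hf_cont
  have hmono : StrictMonoOn ξ (Ioc 0 1) := by
    refine (strictMonoOn_integral_div_of_log_concave hFc hFpos hlog.concaveOn).congr ?_
    intro x hx
    have hx0 := (hFpos x hx).ne'
    show _ / _ = _
    rw [hξ, integral_primitive_eq hf_cont hF (Ioc_subset_Icc_self hx), sub_div,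
      mul_div_cancel_right₀ _ hx0]
  have hξ_lt : ∀ x ∈ Ioc (0 : ℝ) 1, ξ x < x := fun x hx => by
    have : 0 < ∫ t in (0 : ℝ)..x, t * f t := intervalIntegral_pos_of_pos_on
      (intervalIntegrable_of_continuousOn_unit htf (by simp) (Ioc_subset_Icc_self hx))
      (fun t ht => mul_pos ht.1 (hf_pos t ⟨ht.1.le, ht.2.le.trans hx.2⟩)) hx.1
    have := div_pos this (hFpos x hx)
    rw [hξ]; linarith
  have hξc : ContinuousOn ξ (Ioc 0 1) := by
    rw [funext hξ]
    exact continuousOn_id.sub (((continuousOn_primitive_unit htf).mono Ioc_subset_Icc_self).div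
      (hFc.mono Ioc_subset_Icc_self) fun x hx => (hFpos x hx).ne')
  have hξ_one : ξ 1 = 1 - μ := by
    rw [hξ, hF 1, hf_int, ← hμdef, div_one]
  have hγ_one : γ < 1 := by linarith [hμ.1]
  obtain ⟨x, hx, hxγ⟩ : γ ∈ ξ '' Icc γ 1 :=
    intermediate_value_Icc hγ_one.le (hξc.mono fun t ht => ⟨hγ.trans_le ht.1, ht.2⟩)
      ⟨(hξ_lt γ ⟨hγ, hγ_one.le⟩).le, by rw [hξ_one]; exact hγ'.le⟩
  have hxI : x ∈ Ioc (0 : ℝ) 1 := ⟨hγ.trans_le hx.1, hx.2⟩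
  have hx_one : x < 1 := lt_of_le_of_ne hx.2 fun h => by
    rw [h, hξ_one] at hxγ; linarith
  have hγx : γ < x := hxγ ▸ hξ_lt x hxI
  refine ⟨x - γ, ⟨by linarith, by linarith⟩, ?_, fun β hβ h => ?_, ?_, fun y hy h => ?_⟩
  · rw [sub_add_cancel]
    linarith [hξ x]
  · have hβI : β + γ ∈ Ioc (0 : ℝ) 1 := ⟨by linarith [hβ.1], by linarith [hβ.2]⟩
    have := hmono.injOn hβI hxI (by linarith [hξ (β + γ)])
    linarith
  · rw [sub_add_cancel, hxγ]
  · rw [sub_add_cancel]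
    exact hmono.injOn (Ioo_subset_Ioc_self hy) hxI (h.trans hxγ.symm)
end

section
/- Fix α ∈ [0,μ], γ > 0 and κ > 0. Every Q ∈ M(F) that maximizes ∫₀¹ V_α(x) dQ(x) over M(F) has the property that the topological support of Q contains at most one point in [0, α+γ] and at most one point in [α+γ, 1]; in particular, the support of Q contains at most two points. -/
open MeasureTheory Set intervalIntegral

/-- The cumulative distribution function of a Borel measure on `ℝ`. -/
noncomputable def mcdf (Q : Measure ℝ) (s : ℝ) : ℝ := (Q (Iic s)).toReal

/-- `Q` is a mean-preserving contraction of `Q'`. -/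
def IsMPC (Q Q' : Measure ℝ) : Prop :=
  (∀ x ∈ Icc (0:ℝ) 1, (∫ s in (0:ℝ)..x, mcdf Q s) ≤ ∫ s in (0:ℝ)..x, mcdf Q' s) ∧
    (∫ s in (0:ℝ)..1, mcdf Q s) = ∫ s in (0:ℝ)..1, mcdf Q' s

/-- `Q ∈ 𝓜(F)`: `Q` is a probability measure on `[0,1]` that is a mean-preserving
contraction of the prior `P`. -/
def MemM (P Q : Measure ℝ) : Prop :=
  IsProbabilityMeasure Q ∧ Q (Icc (0:ℝ) 1)ᶜ = 0 ∧ IsMPC Q P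

/-- The topological support of a measure on `ℝ`: points all of whose neighborhoods have
positive measure. -/
def msupport (Q : Measure ℝ) : Set ℝ := {x | ∀ U ∈ nhds x, Q U ≠ 0}

/-- The integrated distribution function of a finite measure on `[0,1]` is its integral against
the convex kink functions. -/
lemma integral_mcdf_eq (Q : Measure ℝ) [IsFiniteMeasure Q] (hQ : Q (Icc (0:ℝ) 1)ᶜ = 0)
    {x : ℝ} (hx : 0 ≤ x) :
    (∫ s in (0:ℝ)..x, mcdf Q s) = ∫ t, max (x - t) 0 ∂Q := by
  have hcdf : ∀ s, mcdf Q s = ∫ t, (if t ≤ s then (1:ℝ) else 0) ∂Q := by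
    intro s
    have h : (fun t : ℝ => if t ≤ s then (1:ℝ) else 0) = (Iic s).indicator fun _ => (1:ℝ) := by
      ext t; simp [indicator]
    rw [h, MeasureTheory.integral_indicator measurableSet_Iic]
    simp [mcdf, Measure.real]
  have hmeas : Measurable (Function.uncurry fun s t : ℝ => if t ≤ s then (1:ℝ) else 0) :=
    Measurable.ite (measurableSet_le measurable_snd measurable_fst) measurable_const
      measurable_const
  have hint : Integrable (Function.uncurry fun s t : ℝ => if t ≤ s then (1:ℝ) else 0)
      ((volume.restrict (Ioc 0 x)).prod Q) := by
    refine Integrable.of_bound hmeas.aestronglyMeasurable 1 (Filter.Eventually.of_forall ?_)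
    rintro ⟨s, t⟩
    simp only [Function.uncurry]
    split_ifs <;> simp
  rw [intervalIntegral.integral_of_le hx]
  simp_rw [hcdf]
  rw [integral_integral_swap hint]
  have hae : ∀ᵐ t ∂Q, t ∈ Icc (0:ℝ) 1 := hQ
  refine integral_congr_ae ?_
  filter_upwards [hae] with t ht
  have h : (fun s : ℝ => if t ≤ s then (1:ℝ) else 0) = (Ici t).indicator fun _ => (1:ℝ) := by
    ext s; simp [indicator]
  rw [h, MeasureTheory.integral_indicator measurableSet_Ici,
    Measure.restrict_restrict measurableSet_Ici]
  have hae' : (Ici t ∩ Ioc 0 x : Set ℝ) =ᵐ[volume] Icc t x := by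
    have h1 : (Ioc t x : Set ℝ) ⊆ Ici t ∩ Ioc 0 x := fun s hs =>
      ⟨hs.1.le, ht.1.trans_lt hs.1, hs.2⟩
    have h2 : (Ici t ∩ Ioc 0 x : Set ℝ) ⊆ Icc t x := fun s hs => ⟨hs.1, hs.2.2⟩
    exact h2.eventuallyLE.antisymm (Ioc_ae_eq_Icc.symm.le.trans h1.eventuallyLE)
  rw [Measure.restrict_congr_set hae']
  simp [Measure.real, ENNReal.toReal_ofReal']

/-- The measure obtained from `Q` by pooling its restriction to `I` at the barycenter. -/
noncomputable def pool (Q : Measure ℝ) (I : Set ℝ) : Measure ℝ :=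
  Q.restrict Iᶜ + Q I • Measure.dirac (⨍ t in I, t ∂Q)

lemma integrable_of_measure_compl_Icc_eq_zero {Q : Measure ℝ} [IsFiniteMeasure Q]
    (hQ : Q (Icc (0:ℝ) 1)ᶜ = 0) {g : ℝ → ℝ} (hg : Continuous g) : Integrable g Q := by
  have h : IntegrableOn g (Icc 0 1) Q := hg.continuousOn.integrableOn_compact isCompact_Icc
  rwa [IntegrableOn, Measure.restrict_eq_self_of_ae_mem (show ∀ᵐ t ∂Q, t ∈ Icc (0:ℝ) 1 from hQ)]
    at h

lemma integral_pool {Q : Measure ℝ} [IsFiniteMeasure Q] {I : Set ℝ} {g : ℝ → ℝ}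
    (hg : Integrable g Q) :
    ∫ t, g t ∂pool Q I = (∫ t in Iᶜ, g t ∂Q) + Q.real I * g (⨍ t in I, t ∂Q) := by
  have hd : Integrable g (Q I • Measure.dirac (⨍ t in I, t ∂Q)) :=
    (integrable_dirac (by simp)).smul_measure (measure_ne_top Q I)
  rw [pool, integral_add_measure hg.restrict hd, MeasureTheory.integral_smul_measure,
    integral_dirac]
  simp [Measure.real]

lemma integral_eq_compl_add_mul_average {Q : Measure ℝ} [IsFiniteMeasure Q] {I : Set ℝ}
    (hI : MeasurableSet I) {g : ℝ → ℝ} (hg : Integrable g Q) :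
    ∫ t, g t ∂Q = (∫ t in Iᶜ, g t ∂Q) + Q.real I * ⨍ t in I, g t ∂Q := by
  rw [← integral_add_compl hI hg, add_comm, ← measure_smul_setAverage g (measure_ne_top Q I),
    smul_eq_mul]

/-- Pooling a measure on a compact interval preserves membership in `𝓜(F)`. -/
lemma memM_pool {P Q : Measure ℝ} (h : MemM P Q) {l u : ℝ} (hl : 0 ≤ l) (hu : u ≤ 1)
    (hI : Q (Icc l u) ≠ 0) : MemM P (pool Q (Icc l u)) := by
  obtain ⟨hprob, hsupp, hmpc, hmean⟩ := h
  have hid : Integrable (fun t : ℝ => t) Q :=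
    integrable_of_measure_compl_Icc_eq_zero hsupp continuous_id
  have hmem : ∀ᵐ t ∂Q.restrict (Icc l u), t ∈ Icc l u := ae_restrict_mem measurableSet_Icc
  have hp : (⨍ t in Icc l u, t ∂Q) ∈ Icc l u :=
    (convex_Icc l u).set_average_mem isClosed_Icc hI (measure_ne_top Q _) hmem
      hid.integrableOn
  have hp' : (⨍ t in Icc l u, t ∂Q) ∈ Icc (0:ℝ) 1 := ⟨hl.trans hp.1, hp.2.trans hu⟩
  have hprob' : IsProbabilityMeasure (pool Q (Icc l u)) := by
    constructor
    simp only [pool, Measure.add_apply, Measure.smul_apply, Measure.restrict_apply_univ,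
      measure_univ, smul_eq_mul, mul_one]
    rw [add_comm, measure_add_measure_compl measurableSet_Icc, measure_univ]
  have hsupp' : pool Q (Icc l u) (Icc (0:ℝ) 1)ᶜ = 0 := by
    have h0 : Q.restrict (Icc l u)ᶜ (Icc (0:ℝ) 1)ᶜ = 0 :=
      le_antisymm ((Measure.restrict_apply_le _ _).trans hsupp.le) zero_le
    simp only [pool, Measure.add_apply, Measure.smul_apply, h0, zero_add, smul_eq_mul]
    rw [Measure.dirac_apply' _ measurableSet_Icc.compl, indicator_of_notMem (by simpa using hp'),
      mul_zero]
  have hkink : ∀ x : ℝ, Continuous fun t : ℝ => max (x - t) 0 := fun x => by fun_prop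
  have hkinkint := fun x => integrable_of_measure_compl_Icc_eq_zero hsupp (hkink x)
  refine ⟨hprob', hsupp', fun x hx => le_trans ?_ (hmpc x hx), Eq.trans ?_ hmean⟩
  · rw [integral_mcdf_eq _ hsupp' hx.1, integral_mcdf_eq _ hsupp hx.1, integral_pool (hkinkint x),
      integral_eq_compl_add_mul_average measurableSet_Icc (hkinkint x)]
    have hconv : ConvexOn ℝ (Icc l u) fun t : ℝ => max (x - t) 0 :=
      ((convexOn_const x (convex_Icc l u)).sub (concaveOn_id (convex_Icc l u))).sup
        (convexOn_const 0 (convex_Icc l u))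
    have hJ := hconv.map_set_average_le (hkink x).continuousOn isClosed_Icc hI
      (measure_ne_top Q _) hmem hid.integrableOn (hkinkint x).integrableOn
    gcongr
  · have hmean' : ∀ N : Measure ℝ, IsProbabilityMeasure N → N (Icc (0:ℝ) 1)ᶜ = 0 →
        (∫ s in (0:ℝ)..1, mcdf N s) = ∫ t, (1 - t) ∂N := by
      intro N hN hNs
      rw [integral_mcdf_eq N hNs zero_le_one]
      refine integral_congr_ae ?_
      filter_upwards [show ∀ᵐ t ∂N, t ∈ Icc (0:ℝ) 1 from hNs] with t ht
      exact max_eq_left (by linarith [ht.2])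
    have hsub : Integrable (fun t : ℝ => 1 - t) Q := (integrable_const 1).sub hid
    rw [hmean' _ hprob' hsupp', hmean' _ hprob hsupp, integral_pool hsub,
      integral_eq_compl_add_mul_average measurableSet_Icc hsub]
    have havg := measure_smul_setAverage (fun t : ℝ => 1 - t) (measure_ne_top Q (Icc l u))
    have havg' := measure_smul_setAverage (fun t : ℝ => t) (measure_ne_top Q (Icc l u))
    rw [integral_sub (integrable_const 1) hid.integrableOn] at havg
    simp only [smul_eq_mul, MeasureTheory.integral_const, measureReal_restrict_apply_univ, mul_one]
      at havg havg'
    rw [havg, ← havg']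
    ring

/-- A maximizer over `𝓜(F)` has at most one atom, and no other mass, on any compact interval
where the objective is strictly concave. -/
lemma exists_measure_diff_singleton_eq_zero {P Q : Measure ℝ} (hQ : MemM P Q) {V : ℝ → ℝ}
    (hV : Continuous V)
    (hmax : ∀ Q' : Measure ℝ, MemM P Q' → (∫ x, V x ∂Q') ≤ ∫ x, V x ∂Q)
    {l u : ℝ} (hl : 0 ≤ l) (hu : u ≤ 1) (hconc : StrictConcaveOn ℝ (Icc l u) V) :
    ∃ p, Q (Icc l u \ {p}) = 0 := by
  by_cases hI : Q (Icc l u) = 0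
  · exact ⟨0, measure_mono_null sdiff_subset hI⟩
  obtain ⟨hprob, hsupp, -⟩ := id hQ
  have hid : Integrable (fun t : ℝ => t) Q :=
    integrable_of_measure_compl_Icc_eq_zero hsupp continuous_id
  have hVint := integrable_of_measure_compl_Icc_eq_zero hsupp hV
  have hle := hmax _ (memM_pool hQ hl hu hI)
  rw [integral_pool hVint, integral_eq_compl_add_mul_average measurableSet_Icc hVint] at hle
  have hpos : 0 < Q.real (Icc l u) := ENNReal.toReal_pos hI (measure_ne_top Q _)
  have hle' := le_of_mul_le_mul_left (le_of_add_le_add_left hle) hpos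
  rcases hconc.ae_eq_const_or_lt_map_average hV.continuousOn isClosed_Icc
    (ae_restrict_mem measurableSet_Icc) hid.integrableOn hVint.integrableOn with h | h
  · refine ⟨⨍ t in Icc l u, t ∂Q, ?_⟩
    rw [sdiff_eq, inter_comm,
      ← Measure.restrict_apply (measurableSet_singleton _).compl]
    exact h
  · exact absurd hle' h.not_ge

/-- A measure that vanishes off a finite set has an atom at each point of its support. -/
lemma measure_singleton_ne_zero_of_mem_msupport {Q : Measure ℝ} {S : Set ℝ} (hS : S.Finite)
    (hQ : Q Sᶜ = 0) {x : ℝ} (hx : x ∈ msupport Q) : Q {x} ≠ 0 := by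
  intro h0
  refine hx (S \ {x})ᶜ
    ((hS.subset sdiff_subset).isClosed.isOpen_compl.mem_nhds (by simp)) ?_
  refine measure_mono_null (t := Sᶜ ∪ {x}) ?_ (measure_union_null hQ h0)
  intro y hy
  by_cases hyS : y ∈ S
  · exact Or.inr (by_contra fun hyx => hy ⟨hyS, hyx⟩)
  · exact Or.inl hyS

/-- For fixed `α ∈ [0,μ]`, `γ > 0`, `κ > 0`, any maximizer of
`∫ V_α dQ` over `𝓜(F)`, where `V_α x = max α (x - γ) - κ c x`, has topological support
containing at most one point of `[0, α+γ]` and at most one point of `[α+γ, 1]`; in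
particular its support has at most two points. -/
theorem optimal_acquisition_coarse
    (f : ℝ → ℝ) (P : Measure ℝ)
    (hf_cont : ContinuousOn f (Icc 0 1))
    (hf_pos : ∀ t ∈ Icc (0:ℝ) 1, 0 < f t)
    (hP : P = (volume.restrict (Icc (0:ℝ) 1)).withDensity fun t => ENNReal.ofReal (f t))
    (hPprob : IsProbabilityMeasure P)
    (μ : ℝ) (hμdef : μ = ∫ t in (0:ℝ)..1, t * f t) (hμ : μ ∈ Ioo (0:ℝ) 1)
    (hlog : StrictConcaveOn ℝ (Ioc (0:ℝ) 1) fun x => Real.log (∫ t in (0:ℝ)..x, f t))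
    (c : ℝ → ℝ) (hc : ContDiff ℝ 2 c) (hcconv : StrictConvexOn ℝ (Icc 0 1) c)
    (hcμ : c μ = 0)
    (κ γ α : ℝ) (hκ : 0 < κ) (hγ : 0 < γ) (hα : α ∈ Icc 0 μ)
    (Q : Measure ℝ) (hQ : MemM P Q)
    (hQmax : ∀ Q' : Measure ℝ, MemM P Q' →
      (∫ x, (max α (x - γ) - κ * c x) ∂Q') ≤ ∫ x, (max α (x - γ) - κ * c x) ∂Q) :
    (msupport Q ∩ Icc 0 (α + γ)).Subsingleton ∧
      (msupport Q ∩ Icc (α + γ) 1).Subsingleton ∧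
      ∃ a b : ℝ, msupport Q ⊆ {a, b} := by
  obtain ⟨-, hsupp, -⟩ := id hQ
  have hV : Continuous fun x => max α (x - γ) - κ * c x :=
    (by fun_prop : Continuous fun x : ℝ => max α (x - γ)).sub (hc.continuous.const_mul κ)
  have hcκ : ∀ ⦃l u : ℝ⦄, 0 ≤ l → u ≤ 1 → StrictConvexOn ℝ (Icc l u) fun x => κ * c x := by
    intro l u hl hu
    have h := hcconv.subset (Icc_subset_Icc hl hu) (convex_Icc l u)
    refine ⟨h.1, fun x hx y hy hxy a b ha hb hab => ?_⟩
    have := mul_lt_mul_of_pos_left (h.2 hx hy hxy ha hb hab) hκ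
    simp only [smul_eq_mul] at this ⊢
    linarith
  have hα0 : 0 ≤ α + γ := add_nonneg hα.1 hγ.le
  have hlow : StrictConcaveOn ℝ (Icc 0 (min (α + γ) 1)) fun x => max α (x - γ) - κ * c x := by
    refine ((concaveOn_const α (convex_Icc _ _)).sub_strictConvexOn
      (hcκ le_rfl (min_le_right _ _))).congr fun x hx => ?_
    have : max α (x - γ) = α := max_eq_left (by linarith [hx.2.trans (min_le_left _ _)])
    simp [this]
  have hhigh : StrictConcaveOn ℝ (Icc (α + γ) 1) fun x => max α (x - γ) - κ * c x := by
    refine (((concaveOn_id (convex_Icc _ _)).sub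
      (convexOn_const γ (convex_Icc _ _))).sub_strictConvexOn
      (hcκ hα0 le_rfl)).congr fun x hx => ?_
    have : max α (x - γ) = x - γ := max_eq_right (by linarith [hx.1])
    simp [this]
  obtain ⟨p, hp⟩ := exists_measure_diff_singleton_eq_zero hQ hV hQmax le_rfl
    (min_le_right _ _) hlow
  obtain ⟨q, hq⟩ := exists_measure_diff_singleton_eq_zero hQ hV hQmax hα0 le_rfl hhigh
  have hpq : Q ({p, q} : Set ℝ)ᶜ = 0 := by
    refine measure_mono_null ?_ (measure_union_null hsupp (measure_union_null hp hq))
    intro y hy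
    simp only [mem_compl_iff, mem_insert_iff, mem_singleton_iff, not_or] at hy
    by_cases hy1 : y ∈ Icc (0:ℝ) 1
    · rcases le_total y (α + γ) with h | h
      · exact Or.inr (Or.inl ⟨⟨hy1.1, le_min h hy1.2⟩, hy.1⟩)
      · exact Or.inr (Or.inr ⟨⟨h, hy1.2⟩, hy.2⟩)
    · exact Or.inl hy1
  have hatom : ∀ x ∈ msupport Q, Q {x} ≠ 0 := fun x hx =>
    measure_singleton_ne_zero_of_mem_msupport (toFinite {p, q}) hpq hx
  have heq : ∀ {I : Set ℝ} {r : ℝ}, Q (I \ {r}) = 0 → ∀ x ∈ msupport Q, x ∈ I → x = r :=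
    fun {I r} h x hx hxI => by_contra fun hxr =>
      hatom x hx (measure_mono_null (t := I \ {r}) (singleton_subset_iff.2 ⟨hxI, hxr⟩) h)
  have hle1 : ∀ x ∈ msupport Q, x ≤ 1 := fun x hx => by_contra fun h =>
    hatom x hx (measure_mono_null (t := (Icc (0:ℝ) 1)ᶜ)
      (singleton_subset_iff.2 fun h' => h h'.2) hsupp)
  refine ⟨?_, ?_, p, q, fun x hx => by_contra fun h =>
    hatom x hx (measure_mono_null (t := ({p, q} : Set ℝ)ᶜ) (singleton_subset_iff.2 h) hpq)⟩
  · rintro x ⟨hx, hxI⟩ y ⟨hy, hyI⟩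
    rw [heq hp x hx ⟨hxI.1, le_min hxI.2 (hle1 x hx)⟩,
      heq hp y hy ⟨hyI.1, le_min hyI.2 (hle1 y hy)⟩]
  · rintro x ⟨hx, hxI⟩ y ⟨hy, hyI⟩
    rw [heq hq x hx hxI, heq hq y hy hyI]
end

section
/- Fix γ > 0 and κ > 0. Suppose that for every α ∈ [0,μ] the problem of maximizing ∫₀¹ V_α(x) dQ(x) over Q ∈ M(F) has a unique solution Q_α, and that the topological support of Q_α contains exactly two points for every α ∈ [0,μ]. Then the map L : [0,μ] → [0,1] defined by L(α) := min(supp(Q_α)) is continuous. -/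
open MeasureTheory Set intervalIntegral

/-- The measure with mass `p` at `a` and mass `1 - p` at `b`. -/
noncomputable def twoPoint (a b p : ℝ) : Measure ℝ :=
  ENNReal.ofReal p • Measure.dirac a + ENNReal.ofReal (1 - p) • Measure.dirac b

lemma twoPoint_apply (a b p : ℝ) {s : Set ℝ} (hs : MeasurableSet s) :
    twoPoint a b p s = ENNReal.ofReal p * s.indicator 1 a +
      ENNReal.ofReal (1 - p) * s.indicator 1 b := by
  simp [twoPoint, Measure.dirac_apply' _ hs]

lemma isProbabilityMeasure_twoPoint (a b : ℝ) {p : ℝ} (hp : p ∈ Icc (0 : ℝ) 1) :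
    IsProbabilityMeasure (twoPoint a b p) := by
  refine ⟨?_⟩
  rw [twoPoint_apply a b p MeasurableSet.univ]
  simp [← ENNReal.ofReal_add hp.1 (sub_nonneg.2 hp.2)]

lemma integral_twoPoint (a b : ℝ) {p : ℝ} (hp : p ∈ Icc (0 : ℝ) 1) (g : ℝ → ℝ) :
    ∫ x, g x ∂(twoPoint a b p) = p * g a + (1 - p) * g b := by
  have hd : ∀ y : ℝ, Integrable g (Measure.dirac y) := fun y =>
    integrable_dirac (by simp)
  rw [twoPoint, integral_add_measure ((hd a).smul_measure ENNReal.ofReal_ne_top)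
    ((hd b).smul_measure ENNReal.ofReal_ne_top), MeasureTheory.integral_smul_measure,
    MeasureTheory.integral_smul_measure,
    integral_dirac, integral_dirac, ENNReal.toReal_ofReal hp.1,
    ENNReal.toReal_ofReal (sub_nonneg.2 hp.2), smul_eq_mul, smul_eq_mul]

lemma mcdf_twoPoint (a b : ℝ) {p : ℝ} (hp : p ∈ Icc (0 : ℝ) 1) (s : ℝ) :
    mcdf (twoPoint a b p) s =
      p * (Ici a).indicator 1 s + (1 - p) * (Ici b).indicator 1 s := by
  have h1 := sub_nonneg.2 hp.2
  rw [mcdf, twoPoint_apply a b p measurableSet_Iic]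
  by_cases ha : a ≤ s <;> by_cases hb : b ≤ s <;>
    simp [indicator, ha, hb, ENNReal.toReal_add, ENNReal.toReal_ofReal hp.1,
      ENNReal.toReal_ofReal h1]

lemma intervalIntegrable_indicator_Ici (a x y : ℝ) :
    IntervalIntegrable ((Ici a).indicator (1 : ℝ → ℝ)) volume x y := by
  refine Monotone.intervalIntegrable fun s t hst => ?_
  by_cases hs : a ≤ s
  · simp [indicator, hs, hs.trans hst]
  · by_cases ht : a ≤ t <;> simp [indicator, hs, ht]

lemma integral_indicator_Ici {a x : ℝ} (ha : 0 ≤ a) (hx : 0 ≤ x) :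
    ∫ s in (0 : ℝ)..x, (Ici a).indicator (1 : ℝ → ℝ) s = max (x - a) 0 := by
  rw [integral_of_le hx, ← integral_Icc_eq_integral_Ioc, setIntegral_indicator measurableSet_Ici]
  have : Icc 0 x ∩ Ici a = Icc a x := by
    ext s
    simp only [mem_inter_iff, mem_Icc, mem_Ici]
    exact ⟨fun h => ⟨h.2, h.1.2⟩, fun h => ⟨⟨ha.trans h.1, h.2⟩, h.1⟩⟩
  rw [this]
  simp [Measure.real, ENNReal.toReal_ofReal']

lemma integral_mcdf_twoPoint {a b p x : ℝ} (ha : 0 ≤ a) (hb : 0 ≤ b) (hp : p ∈ Icc (0 : ℝ) 1)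
    (hx : 0 ≤ x) :
    ∫ s in (0 : ℝ)..x, mcdf (twoPoint a b p) s =
      p * max (x - a) 0 + (1 - p) * max (x - b) 0 := by
  simp_rw [mcdf_twoPoint a b hp]
  rw [intervalIntegral.integral_add ((intervalIntegrable_indicator_Ici a 0 x).const_mul p)
    ((intervalIntegrable_indicator_Ici b 0 x).const_mul (1 - p)),
    intervalIntegral.integral_const_mul, intervalIntegral.integral_const_mul,
    integral_indicator_Ici ha hx, integral_indicator_Ici hb hx]

lemma msupport_eq_support (Q : Measure ℝ) : msupport Q = Q.support := by
  ext x
  simp [msupport, Measure.mem_support_iff_forall, pos_iff_ne_zero]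

lemma measure_compl_msupport (Q : Measure ℝ) : Q (msupport Q)ᶜ = 0 := by
  rw [msupport_eq_support]
  exact Measure.measure_compl_support

lemma msupport_subset_of_isClosed {Q : Measure ℝ} {s : Set ℝ} (hs : IsClosed s) (h : Q sᶜ = 0) :
    msupport Q ⊆ s := by
  intro x hx
  by_contra hxs
  exact hx _ (hs.isOpen_compl.mem_nhds hxs) h

lemma msupport_twoPoint_subset (a b p : ℝ) : msupport (twoPoint a b p) ⊆ {a, b} := by
  refine msupport_subset_of_isClosed (Set.toFinite _).isClosed ?_
  rw [twoPoint_apply _ _ _ (Set.toFinite _).measurableSet.compl]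
  simp

lemma eq_twoPoint_of_measure_compl {Q : Measure ℝ} [IsProbabilityMeasure Q] {a b : ℝ}
    (hab : a ≠ b) (h : Q {a, b}ᶜ = 0) :
    ∃ p ∈ Icc (0 : ℝ) 1, Q = twoPoint a b p := by
  have hQ : Q = Q {a} • Measure.dirac a + Q {b} • Measure.dirac b := by
    conv_lhs => rw [← Measure.restrict_eq_self_of_ae_mem (μ := Q) (s := {a, b}) h]
    rw [insert_eq, Measure.restrict_union (by simpa using hab) (measurableSet_singleton b),
      Measure.restrict_singleton, Measure.restrict_singleton]
  have hsum : Q.real {a} + Q.real {b} = 1 := by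
    have h1 : Q univ = Q {a} + Q {b} := by
      conv_lhs => rw [hQ]
      simp
    rw [measure_univ] at h1
    simp [Measure.real, ← ENNReal.toReal_add, ← h1]
  refine ⟨Q.real {a}, ⟨measureReal_nonneg, measureReal_le_one⟩, ?_⟩
  conv_lhs => rw [hQ]
  rw [twoPoint, ← eq_sub_of_add_eq' hsum, ofReal_measureReal, ofReal_measureReal]

lemma exists_eq_twoPoint {Q : Measure ℝ} [IsProbabilityMeasure Q] {s : Set ℝ} (hs : IsClosed s)
    (hQ : Q sᶜ = 0) (h : ∃ a b : ℝ, a ≠ b ∧ msupport Q = {a, b}) :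
    ∃ a ∈ s, ∃ b ∈ s, ∃ p ∈ Icc (0 : ℝ) 1,
      a ≤ b ∧ Q = twoPoint a b p ∧ sInf (msupport Q) = a := by
  obtain ⟨a, b, hab, hsupp⟩ := h
  wlog hlt : a ≤ b generalizing a b
  · exact this b a hab.symm (by rw [hsupp, pair_comm]) (le_of_not_ge hlt)
  have hsub := msupport_subset_of_isClosed hs hQ
  rw [hsupp] at hsub
  obtain ⟨p, hp, hQp⟩ := eq_twoPoint_of_measure_compl hab (hsupp ▸ measure_compl_msupport Q)
  exact ⟨a, hsub (by simp), b, hsub (by simp), p, hp, hlt, hQp, by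
    rw [hsupp, csInf_pair, min_eq_left hlt]⟩

lemma sInf_msupport_twoPoint {a b p : ℝ} (hab : a ≤ b)
    (h : ∃ a' b' : ℝ, a' ≠ b' ∧ msupport (twoPoint a b p) = {a', b'}) :
    sInf (msupport (twoPoint a b p)) = a := by
  obtain ⟨a', b', hne, hsupp⟩ := h
  have hsub := msupport_twoPoint_subset a b p
  have heq : msupport (twoPoint a b p) = {a, b} := by
    refine Set.eq_of_subset_of_ncard_le hsub ?_
    rw [hsupp, ncard_pair hne]
    exact (ncard_insert_le a {b}).trans (by simp)
  rw [heq, csInf_pair, min_eq_left hab]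

lemma Continuous.integrable_of_measure_compl_Icc {Q : Measure ℝ} [IsFiniteMeasure Q] {a b : ℝ}
    (hQ : Q (Icc a b)ᶜ = 0) {g : ℝ → ℝ} (hg : Continuous g) : Integrable g Q := by
  rw [← Measure.restrict_eq_self_of_ae_mem (μ := Q) (s := Icc a b) hQ]
  exact hg.integrableOn_Icc

lemma integral_max_sub_le {Q : Measure ℝ} [IsProbabilityMeasure Q] (hQ : Q (Icc (0 : ℝ) 1)ᶜ = 0)
    {g h : ℝ → ℝ} (hg : Continuous g) (hh : Continuous h) (α β : ℝ) :
    ∫ x, (max α (g x) - h x) ∂Q ≤ ∫ x, (max β (g x) - h x) ∂Q + |α - β| := by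
  have hint : ∀ t : ℝ, Integrable (fun x => max t (g x) - h x) Q := fun t =>
    Continuous.integrable_of_measure_compl_Icc hQ (by fun_prop)
  calc ∫ x, (max α (g x) - h x) ∂Q ≤ ∫ x, ((max β (g x) - h x) + |α - β|) ∂Q := by
        refine integral_mono (hint α) ((hint β).add (integrable_const _)) fun x => ?_
        have : max α (g x) ≤ max β (g x) + |α - β| :=
          max_le (by linarith [le_abs_self (α - β), le_max_left β (g x)])
            (by linarith [abs_nonneg (α - β), le_max_right β (g x)])
        simp only
        linarith
    _ = _ := by rw [integral_add (hint β) (integrable_const _)]; simp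

lemma memM_twoPoint_of_tendsto {P : Measure ℝ} {u v w : ℕ → ℝ} {a b p : ℝ}
    (hu : ∀ n, u n ∈ Icc (0 : ℝ) 1) (hv : ∀ n, v n ∈ Icc (0 : ℝ) 1)
    (hw : ∀ n, w n ∈ Icc (0 : ℝ) 1) (hua : Filter.Tendsto u Filter.atTop (nhds a))
    (hvb : Filter.Tendsto v Filter.atTop (nhds b)) (hwp : Filter.Tendsto w Filter.atTop (nhds p))
    (hM : ∀ n, MemM P (twoPoint (u n) (v n) (w n))) : MemM P (twoPoint a b p) := by
  have ha : a ∈ Icc (0 : ℝ) 1 := isClosed_Icc.mem_of_tendsto hua (.of_forall hu)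
  have hb : b ∈ Icc (0 : ℝ) 1 := isClosed_Icc.mem_of_tendsto hvb (.of_forall hv)
  have hp : p ∈ Icc (0 : ℝ) 1 := isClosed_Icc.mem_of_tendsto hwp (.of_forall hw)
  have hlim : ∀ x ∈ Icc (0 : ℝ) 1, Filter.Tendsto
      (fun n => ∫ s in (0 : ℝ)..x, mcdf (twoPoint (u n) (v n) (w n)) s) Filter.atTop
      (nhds (∫ s in (0 : ℝ)..x, mcdf (twoPoint a b p) s)) := by
    intro x hx
    simp_rw [fun n => integral_mcdf_twoPoint (hu n).1 (hv n).1 (hw n) hx.1]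
    rw [integral_mcdf_twoPoint ha.1 hb.1 hp hx.1]
    exact (hwp.mul ((tendsto_const_nhds.sub hua).max tendsto_const_nhds)).add
      ((tendsto_const_nhds.sub hwp).mul ((tendsto_const_nhds.sub hvb).max tendsto_const_nhds))
  refine ⟨isProbabilityMeasure_twoPoint a b hp, ?_, fun x hx => ?_, ?_⟩
  · rw [twoPoint_apply _ _ _ measurableSet_Icc.compl]
    simp [ha.1, ha.2, hb.1, hb.2]
  · exact le_of_tendsto (hlim x hx) (.of_forall fun n => (hM n).2.2.1 x hx)
  · refine tendsto_nhds_unique (hlim 1 (by simp)) ?_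
    simp_rw [fun n => (hM n).2.2.2]
    exact tendsto_const_nhds

/-- Fix `γ > 0` and `κ > 0`.  If for every `α ∈ [0,μ]` the problem of
maximizing `∫ V_α dQ` over `𝓜(F)` has the unique solution `Qa α`, and the topological
support of `Qa α` always consists of exactly two points, then
`L α = min (supp (Qa α))` is continuous on `[0,μ]`. -/
theorem lower_support_continuous
    (f : ℝ → ℝ) (P : Measure ℝ)
    (hf_cont : ContinuousOn f (Icc 0 1))
    (hf_pos : ∀ t ∈ Icc (0:ℝ) 1, 0 < f t)
    (hP : P = (volume.restrict (Icc (0:ℝ) 1)).withDensity fun t => ENNReal.ofReal (f t))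
    (hPprob : IsProbabilityMeasure P)
    (μ : ℝ) (hμdef : μ = ∫ t in (0:ℝ)..1, t * f t) (hμ : μ ∈ Ioo (0:ℝ) 1)
    (hlog : StrictConcaveOn ℝ (Ioc (0:ℝ) 1) fun x => Real.log (∫ t in (0:ℝ)..x, f t))
    (c : ℝ → ℝ) (hc : ContDiff ℝ 2 c) (hcconv : StrictConvexOn ℝ (Icc 0 1) c)
    (hcμ : c μ = 0)
    (κ γ : ℝ) (hκ : 0 < κ) (hγ : 0 < γ)
    (Qa : ℝ → Measure ℝ)
    (hQaMem : ∀ α ∈ Icc (0:ℝ) μ, MemM P (Qa α))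
    (hQaMax : ∀ α ∈ Icc (0:ℝ) μ, ∀ Q' : Measure ℝ, MemM P Q' →
      (∫ x, (max α (x - γ) - κ * c x) ∂Q') ≤ ∫ x, (max α (x - γ) - κ * c x) ∂(Qa α))
    (hQaUniq : ∀ α ∈ Icc (0:ℝ) μ, ∀ Q : Measure ℝ, MemM P Q →
      (∀ Q' : Measure ℝ, MemM P Q' →
        (∫ x, (max α (x - γ) - κ * c x) ∂Q') ≤ ∫ x, (max α (x - γ) - κ * c x) ∂Q) →
      Q = Qa α)
    (hQaSupp : ∀ α ∈ Icc (0:ℝ) μ, ∃ a b : ℝ, a ≠ b ∧ msupport (Qa α) = {a, b}) :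
    ContinuousOn (fun α => sInf (msupport (Qa α))) (Icc (0:ℝ) μ) := by
  have hrep : ∀ α ∈ Icc (0 : ℝ) μ, ∃ a ∈ Icc (0 : ℝ) 1, ∃ b ∈ Icc (0 : ℝ) 1, ∃ p ∈ Icc (0 : ℝ) 1,
      a ≤ b ∧ Qa α = twoPoint a b p ∧ sInf (msupport (Qa α)) = a := fun α hα =>
    have := (hQaMem α hα).1
    exists_eq_twoPoint isClosed_Icc (hQaMem α hα).2.1 (hQaSupp α hα)
  choose! A hA B hB p hp hAB hQ hL using hrep
  have hccont := hc.continuous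
  rw [continuousOn_iff_continuous_domRestrict, continuous_iff_seqContinuous]
  intro s α hs
  refine Filter.tendsto_of_subseq_tendsto fun ns hns => ?_
  obtain ⟨⟨a, b, q⟩, -, φ, hφ, hlim⟩ :=
    ((isCompact_Icc (a := (0 : ℝ)) (b := 1)).prod
      ((isCompact_Icc (a := (0 : ℝ)) (b := 1)).prod
        (isCompact_Icc (a := (0 : ℝ)) (b := 1)))).tendsto_subseq
      (x := fun n => (A (s (ns n)), B (s (ns n)), p (s (ns n))))
      fun n => ⟨hA _ (s (ns n)).2, hB _ (s (ns n)).2, hp _ (s (ns n)).2⟩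
  refine ⟨φ, ?_⟩
  set t : ℕ → Icc (0 : ℝ) μ := fun n => s (ns (φ n))
  have htα : Filter.Tendsto (fun n => (t n : ℝ)) Filter.atTop (nhds (α : ℝ)) :=
    (continuous_subtype_val.tendsto α).comp (hs.comp (hns.comp hφ.tendsto_atTop))
  have hAa : Filter.Tendsto (fun n => A (t n)) Filter.atTop (nhds a) := hlim.fst_nhds
  have hBb : Filter.Tendsto (fun n => B (t n)) Filter.atTop (nhds b) := hlim.snd_nhds.fst_nhds
  have hpq : Filter.Tendsto (fun n => p (t n)) Filter.atTop (nhds q) := hlim.snd_nhds.snd_nhds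
  have hab : a ≤ b := le_of_tendsto_of_tendsto' hAa hBb fun n => hAB _ (t n).2
  have hq : q ∈ Icc (0 : ℝ) 1 := isClosed_Icc.mem_of_tendsto hpq (.of_forall fun n => hp _ (t n).2)
  have hmem : MemM P (twoPoint a b q) :=
    memM_twoPoint_of_tendsto (fun n => hA _ (t n).2) (fun n => hB _ (t n).2)
      (fun n => hp _ (t n).2) hAa hBb hpq fun n => hQ _ (t n).2 ▸ hQaMem _ (t n).2
  have hopt : ∀ Q' : Measure ℝ, MemM P Q' →
      (∫ x, (max (α : ℝ) (x - γ) - κ * c x) ∂Q') ≤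
        ∫ x, (max (α : ℝ) (x - γ) - κ * c x) ∂(twoPoint a b q) := by
    intro Q' hQ'
    have := hQ'.1
    rw [integral_twoPoint a b hq]
    have hval : ∀ {u : ℕ → ℝ} {y : ℝ}, Filter.Tendsto u Filter.atTop (nhds y) →
        Filter.Tendsto (fun n => max (t n : ℝ) (u n - γ) - κ * c (u n)) Filter.atTop
          (nhds (max (α : ℝ) (y - γ) - κ * c y)) := fun {u y} hu =>
      (htα.max (hu.sub_const γ)).sub (((hccont.tendsto y).comp hu).const_mul κ)
    have hrhs := (((hpq.mul (hval hAa)).add ((hpq.const_sub 1).mul (hval hBb))).add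
      (htα.const_sub (α : ℝ)).abs)
    rw [sub_self, abs_zero, add_zero] at hrhs
    refine ge_of_tendsto' hrhs fun n => ?_
    refine (integral_max_sub_le hQ'.2.1 (g := fun x => x - γ) (h := fun x => κ * c x)
      (by fun_prop) (by fun_prop) α (t n)).trans ?_
    have h := hQaMax _ (t n).2 Q' hQ'
    rw [hQ _ (t n).2, integral_twoPoint _ _ (hp _ (t n).2)] at h
    gcongr
  have heq : twoPoint a b q = Qa α := hQaUniq α α.2 _ hmem hopt
  have hlimval : sInf (msupport (Qa α)) = a := by
    rw [← heq]
    exact sInf_msupport_twoPoint hab (heq ▸ hQaSupp α α.2)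
  simp only [domRestrict_apply, hlimval]
  exact hAa.congr fun n => (hL _ (t n).2).symm
end

section
/- Fix γ > 0 and κ > 0. There exist α ∈ [0,μ] and a measure Q ∈ M(F) maximizing ∫₀¹ V_α(x) dQ(x) over M(F) such that either Q is the point mass δ_μ at μ, or the topological support of Q consists of exactly two points and min(supp(Q)) = α. (This fixed point is not necessarily unique.) -/
open MeasureTheory Set intervalIntegral

/-- The sender's value function `V_α`. -/
noncomputable def senderValue (c : ℝ → ℝ) (κ γ α x : ℝ) : ℝ := max α (x - γ) - κ * c x

/-- Triples `(a, b, p)` coding the distributions `p δ_a + (1 - p) δ_b` with mean `μ` whose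
integrated distribution function lies below `I`. -/
def binaryContractions (I : ℝ → ℝ) (μ : ℝ) : Set (ℝ × ℝ × ℝ) :=
  {z | 0 ≤ z.1 ∧ z.1 ≤ z.2.1 ∧ z.2.1 ≤ 1 ∧ 0 ≤ z.2.2 ∧ z.2.2 ≤ 1 ∧
    z.2.2 * z.1 + (1 - z.2.2) * z.2.1 = μ ∧
    ∀ x ∈ Icc (0:ℝ) 1,
      z.2.2 * max (x - z.1) 0 + (1 - z.2.2) * max (x - z.2.1) 0 ≤ I x}

/-- The expected value of `V` under the distribution `p δ_a + (1 - p) δ_b`. -/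
def binaryValue (V : ℝ → ℝ) (z : ℝ × ℝ × ℝ) : ℝ := z.2.2 * V z.1 + (1 - z.2.2) * V z.2.1

/-- The measure `p δ_a + (1 - p) δ_b`. -/
noncomputable def binaryMeasure (z : ℝ × ℝ × ℝ) : Measure ℝ :=
  ENNReal.ofReal z.2.2 • Measure.dirac z.1 + ENNReal.ofReal (1 - z.2.2) • Measure.dirac z.2.1

section FiniteDimensional

variable {c : ℝ → ℝ} {κ γ α μ : ℝ} {I : ℝ → ℝ}

theorem strictConcaveOn_senderValue_left (hc : StrictConvexOn ℝ (Icc 0 1) c) (hκ : 0 < κ) :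
    StrictConcaveOn ℝ (Icc 0 (min (α + γ) 1)) (senderValue c κ γ α) := by
  refine ⟨convex_Icc _ _, fun x hx y hy hne s t hs ht hst => ?_⟩
  have hz := convex_Icc 0 (min (α + γ) 1) hx hy hs.le ht.le hst
  have key := hc.2 ⟨hx.1, hx.2.trans (min_le_right _ _)⟩ ⟨hy.1, hy.2.trans (min_le_right _ _)⟩
    hne hs ht hst
  have hx' := hx.2.trans (min_le_left _ _)
  have hy' := hy.2.trans (min_le_left _ _)
  have hz' := hz.2.trans (min_le_left _ _)
  simp only [senderValue, smul_eq_mul] at *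
  rw [max_eq_left (by linarith : x - γ ≤ α), max_eq_left (by linarith : y - γ ≤ α),
    max_eq_left (by linarith : s * x + t * y - γ ≤ α)]
  have h1 := mul_lt_mul_of_pos_left key hκ
  have h2 : α = s * α + t * α := by rw [← add_mul, hst, one_mul]
  linarith

theorem strictConcaveOn_senderValue_right (hc : StrictConvexOn ℝ (Icc 0 1) c) (hκ : 0 < κ)
    (hα : 0 ≤ α + γ) :
    StrictConcaveOn ℝ (Icc (min (α + γ) 1) 1) (senderValue c κ γ α) := by
  refine ⟨convex_Icc _ _, fun x hx y hy hne s t hs ht hst => ?_⟩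
  have hz := convex_Icc (min (α + γ) 1) 1 hx hy hs.le ht.le hst
  have hm : 0 ≤ min (α + γ) 1 := le_min hα zero_le_one
  have key := hc.2 ⟨hm.trans hx.1, hx.2⟩ ⟨hm.trans hy.1, hy.2⟩ hne hs ht hst
  have hk : α + γ ≤ 1 := by
    by_contra! h
    rw [min_eq_right h.le] at hx hy
    exact hne ((le_antisymm hx.2 hx.1).trans (le_antisymm hy.1 hy.2))
  rw [min_eq_left hk] at hx hy hz
  have hx' := hx.1
  have hy' := hy.1
  have hz' := hz.1
  simp only [senderValue, smul_eq_mul] at *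
  rw [max_eq_right (by linarith : α ≤ x - γ), max_eq_right (by linarith : α ≤ y - γ),
    max_eq_right (by linarith : α ≤ s * x + t * y - γ)]
  have h1 := mul_lt_mul_of_pos_left key hκ
  have h2 : γ = s * γ + t * γ := by rw [← add_mul, hst, one_mul]
  linarith

theorem ConcaveOn.add_mul_le_mul_centroid {s : Set ℝ} {V : ℝ → ℝ} (hV : ConcaveOn ℝ s V)
    {x y p q : ℝ} (hx : x ∈ s) (hy : y ∈ s) (hp : 0 < p) (hq : 0 < q) :
    p * V x + q * V y ≤ (p + q) * V ((p * x + q * y) / (p + q)) := by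
  have hpq : 0 < p + q := add_pos hp hq
  have h := hV.2 hx hy (by positivity : 0 ≤ p / (p + q)) (by positivity : 0 ≤ q / (p + q))
    (by field_simp)
  simp only [smul_eq_mul] at h
  rw [show p / (p + q) * x + q / (p + q) * y = (p * x + q * y) / (p + q) by ring] at h
  calc p * V x + q * V y = (p + q) * (p / (p + q) * V x + q / (p + q) * V y) := by field_simp
    _ ≤ _ := by gcongr

theorem StrictConcaveOn.add_mul_lt_mul_centroid {s : Set ℝ} {V : ℝ → ℝ}
    (hV : StrictConcaveOn ℝ s V) {x y p q : ℝ} (hx : x ∈ s) (hy : y ∈ s) (hne : x ≠ y)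
    (hp : 0 < p) (hq : 0 < q) :
    p * V x + q * V y < (p + q) * V ((p * x + q * y) / (p + q)) := by
  have hpq : 0 < p + q := add_pos hp hq
  have h := hV.2 hx hy hne (by positivity : 0 < p / (p + q)) (by positivity : 0 < q / (p + q))
    (by field_simp)
  simp only [smul_eq_mul] at h
  rw [show p / (p + q) * x + q / (p + q) * y = (p * x + q * y) / (p + q) by ring] at h
  calc p * V x + q * V y = (p + q) * (p / (p + q) * V x + q / (p + q) * V y) := by field_simp
    _ < _ := by gcongr

theorem mul_max_sub_centroid_le {p q a b x : ℝ} (hp : 0 < p) (hq : 0 < q) :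
    (p + q) * max (x - (p * a + q * b) / (p + q)) 0 ≤ p * max (x - a) 0 + q * max (x - b) 0 := by
  have hpq : 0 < p + q := add_pos hp hq
  rw [mul_max_of_nonneg _ _ hpq.le, mul_zero]
  apply max_le
  · have : (p + q) * (x - (p * a + q * b) / (p + q)) = p * (x - a) + q * (x - b) := by
      field_simp
      ring
    rw [this]
    gcongr <;> exact le_max_left _ _
  · positivity

theorem isCompact_binaryContractions (I : ℝ → ℝ) (μ : ℝ) :
    IsCompact (binaryContractions I μ) := by
  have hsub : binaryContractions I μ ⊆ Icc 0 1 ×ˢ Icc 0 1 ×ˢ Icc 0 1 := by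
    rintro ⟨a, b, p⟩ ⟨h1, h2, h3, h4, h5, -⟩
    exact ⟨⟨h1, h2.trans h3⟩, ⟨h1.trans h2, h3⟩, ⟨h4, h5⟩⟩
  refine (isCompact_Icc.prod (isCompact_Icc.prod isCompact_Icc)).of_isClosed_subset ?_ hsub
  simp only [binaryContractions, ofPred_and, ofPred_forall]
  refine (isClosed_le (by fun_prop) (by fun_prop)).inter <|
    (isClosed_le (by fun_prop) (by fun_prop)).inter <|
    (isClosed_le (by fun_prop) (by fun_prop)).inter <|
    (isClosed_le (by fun_prop) (by fun_prop)).inter <|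
    (isClosed_le (by fun_prop) (by fun_prop)).inter <|
    (isClosed_eq (by fun_prop) (by fun_prop)).inter <|
    isClosed_biInter fun x _ => isClosed_le (by fun_prop) (by fun_prop)

/-- A nondegenerate maximizer separates the two concave pieces of the objective. -/
theorem le_and_le_of_isMax {V : ℝ → ℝ} {m : ℝ} (hl : StrictConcaveOn ℝ (Icc 0 m) V)
    (hr : StrictConcaveOn ℝ (Icc m 1) V) {a b p : ℝ} (ha : 0 ≤ a) (hab : a < b) (hb : b ≤ 1)
    (hp : 0 < p) (hp1 : p < 1) (hmean : p * a + (1 - p) * b = μ)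
    (hmax : V μ ≤ p * V a + (1 - p) * V b) : a ≤ m ∧ m ≤ b := by
  have aux : ∀ s : Set ℝ, StrictConcaveOn ℝ s V → a ∈ s → b ∈ s → False := fun s hs h1 h2 => by
    have := hs.2 h1 h2 hab.ne hp (sub_pos.2 hp1) (by ring)
    simp only [smul_eq_mul, hmean] at this
    linarith
  constructor
  · by_contra! h
    exact aux _ hr ⟨h.le, hab.le.trans hb⟩ ⟨h.le.trans hab.le, hb⟩
  · by_contra! h
    exact aux _ hl ⟨ha, hab.le.trans h.le⟩ ⟨ha.trans hab.le, h.le⟩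

/-- Two nondegenerate maximizers have the same lower atom. -/
theorem lower_atom_unique {V : ℝ → ℝ} {m : ℝ} (hl : StrictConcaveOn ℝ (Icc 0 m) V)
    (hr : StrictConcaveOn ℝ (Icc m 1) V)
    (hμ : (μ, μ, 1) ∈ binaryContractions I μ)
    {a b p a' b' p' : ℝ} (hz : (a, b, p) ∈ binaryContractions I μ)
    (hz' : (a', b', p') ∈ binaryContractions I μ)
    (hmax : ∀ w ∈ binaryContractions I μ, binaryValue V w ≤ binaryValue V (a, b, p))
    (hmax' : ∀ w ∈ binaryContractions I μ, binaryValue V w ≤ binaryValue V (a', b', p'))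
    (hab : a < b) (hp : 0 < p) (hp1 : p < 1) (hab' : a' < b') (hp' : 0 < p') (hp1' : p' < 1) :
    a = a' := by
  by_contra hne
  have h0 := hmax _ hμ
  have h0' := hmax' _ hμ
  have h1 := hmax _ hz'
  obtain ⟨ha, -, hb, -, -, hmean, hI⟩ := hz
  obtain ⟨ha', -, hb', -, -, hmean', hI'⟩ := hz'
  simp only [binaryValue, sub_self, zero_mul, add_zero, one_mul] at *
  obtain ⟨ham, hmb⟩ := le_and_le_of_isMax hl hr ha hab hb hp hp1 hmean h0
  obtain ⟨ham', hmb'⟩ := le_and_le_of_isMax hl hr ha' hab' hb' hp' hp1' hmean' h0'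
  have hq : 0 < 1 - p := sub_pos.2 hp1
  have hq' : 0 < 1 - p' := sub_pos.2 hp1'
  have hA := hl.add_mul_lt_mul_centroid (p := p) (q := p') ⟨ha, ham⟩ ⟨ha', ham'⟩ hne hp hp'
  have hB := hr.concaveOn.add_mul_le_mul_centroid (p := 1 - p) (q := 1 - p')
    ⟨hmb, hb⟩ ⟨hmb', hb'⟩ hq hq'
  set A := (p * a + p' * a') / (p + p') with hAdef
  set B := ((1 - p) * b + (1 - p') * b') / ((1 - p) + (1 - p')) with hBdef
  have hA' : (p + p') * A = p * a + p' * a' := by rw [hAdef]; field_simp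
  have hB' : ((1 - p) + (1 - p')) * B = (1 - p) * b + (1 - p') * b' := by
    rw [hBdef, mul_div_cancel₀ _ (by linarith)]
  have hA0 : 0 ≤ A := by positivity
  have hAm : A ≤ m := by rw [hAdef, div_le_iff₀ (by linarith)]; nlinarith
  have hmB : m ≤ B := by rw [hBdef, le_div_iff₀ (by linarith)]; nlinarith
  have hB1 : B ≤ 1 := by rw [hBdef, div_le_iff₀ (by linarith)]; nlinarith
  have hw : (A, B, (p + p') / 2) ∈ binaryContractions I μ := by
    refine ⟨hA0, hAm.trans hmB, hB1, by positivity, by linarith, by linarith, fun x hx => ?_⟩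
    have e1 := mul_max_sub_centroid_le (a := a) (b := a') (x := x) hp hp'
    have e2 := mul_max_sub_centroid_le (a := b) (b := b') (x := x) hq hq'
    have e3 := hI x hx
    have e4 := hI' x hx
    rw [← hAdef] at e1
    rw [← hBdef] at e2
    dsimp only at e3 e4 ⊢
    linarith
  have h2 := hmax _ hw
  have h3 := hmax' _ hw
  dsimp only at h2 h3
  linarith

/-- Fixed point of the map sending a conjectured value to the lower atom of the optimal binary
distribution. -/
theorem exists_binary_fixed_point (hc : Continuous c) (hcc : StrictConvexOn ℝ (Icc 0 1) c)
    (hκ : 0 < κ) (hγ : 0 < γ) (hμ : 0 < μ) (hz : (μ, μ, 1) ∈ binaryContractions I μ) :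
    ∃ α ∈ Icc (0:ℝ) μ, ∃ z ∈ binaryContractions I μ,
      (∀ w ∈ binaryContractions I μ,
        binaryValue (senderValue c κ γ α) w ≤ binaryValue (senderValue c κ γ α) z) ∧
      (z = (μ, μ, 1) ∨ (0 < z.2.2 ∧ z.2.2 < 1 ∧ z.1 < z.2.1 ∧ z.1 = α)) := by
  by_contra! hcon
  have hJ : Continuous fun q : ℝ × ℝ × ℝ × ℝ => binaryValue (senderValue c κ γ q.1) q.2 := by
    unfold binaryValue senderValue
    fun_prop
  have hnd : ∀ α ∈ Icc (0:ℝ) μ, ∀ z ∈ binaryContractions I μ,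
      (∀ w ∈ binaryContractions I μ,
        binaryValue (senderValue c κ γ α) w ≤ binaryValue (senderValue c κ γ α) z) →
      0 < z.2.2 ∧ z.2.2 < 1 ∧ z.1 < z.2.1 ∧ z.1 ≠ α ∧ z.1 ≤ μ := by
    rintro α hα ⟨a, b, p⟩ hmem hmax
    have key : ¬ binaryValue (senderValue c κ γ α) (a, b, p) =
        binaryValue (senderValue c κ γ α) (μ, μ, 1) := fun h =>
      (hcon α hα _ hz fun w hw => (hmax w hw).trans h.le).1 rfl
    have hfix := (hcon α hα _ hmem hmax).2
    obtain ⟨h1, h2, h3, h4, h5, h6, -⟩ := hmem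
    dsimp only at *
    simp only [binaryValue] at key
    have hp0 : 0 < p := by
      refine lt_of_le_of_ne h4 fun h => key ?_
      subst h
      simp only [zero_mul, sub_zero, one_mul, zero_add] at h6
      simp [h6]
    have hp1 : p < 1 := by
      refine lt_of_le_of_ne h5 fun h => key ?_
      subst h
      simp only [sub_self, zero_mul, one_mul, add_zero] at h6
      simp [h6]
    have hab : a < b := by
      refine lt_of_le_of_ne h2 fun h => key ?_
      subst h
      have : a = μ := by linarith
      subst this
      ring
    exact ⟨hp0, hp1, hab, hfix hp0 hp1 hab, by nlinarith⟩
  let S : Set (ℝ × ℝ × ℝ × ℝ) := {q | q.1 ∈ Icc 0 μ ∧ q.2 ∈ binaryContractions I μ ∧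
    ∀ w ∈ binaryContractions I μ,
      binaryValue (senderValue c κ γ q.1) w ≤ binaryValue (senderValue c κ γ q.1) q.2}
  have hS : IsCompact S := by
    have hcl : IsClosed {q : ℝ × ℝ × ℝ × ℝ | ∀ w ∈ binaryContractions I μ,
        binaryValue (senderValue c κ γ q.1) w ≤ binaryValue (senderValue c κ γ q.1) q.2} := by
      simp only [ofPred_forall]
      refine isClosed_biInter fun w _ => isClosed_le ?_ hJ
      exact hJ.comp (continuous_fst.prodMk continuous_const)
    have := (isCompact_Icc.prod (isCompact_binaryContractions I μ)).inter_right hcl (s := Icc 0 μ ×ˢ _)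
    convert this using 1
    ext q
    simp [S, and_assoc]
  have hU : IsClosed (Prod.fst '' (S ∩ {q | q.1 ≤ q.2.1})) :=
    ((hS.inter_right (isClosed_le (by fun_prop) (by fun_prop))).image continuous_fst).isClosed
  have hL : IsClosed (Prod.fst '' (S ∩ {q | q.2.1 ≤ q.1})) :=
    ((hS.inter_right (isClosed_le (by fun_prop) (by fun_prop))).image continuous_fst).isClosed
  have hex : ∀ α ∈ Icc (0:ℝ) μ, ∃ z, (α, z) ∈ S := fun α hα => by
    obtain ⟨z, hzK, hzmax⟩ := (isCompact_binaryContractions I μ).exists_isMaxOn ⟨_, hz⟩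
      (hJ.comp (continuous_const (y := α).prodMk continuous_id)).continuousOn
    exact ⟨z, hα, hzK, fun w hw => hzmax hw⟩
  obtain ⟨α, hα, ⟨⟨_, z⟩, ⟨hzS, hzα⟩, rfl⟩, ⟨⟨α', z'⟩, ⟨hzS', hzα'⟩, h⟩⟩ :=
    isPreconnected_closed_iff.1 (isPreconnected_Icc (a := (0:ℝ)) (b := μ)) _ _ hU hL
    (fun α hα => by
      obtain ⟨z, hzS⟩ := hex α hα
      rcases le_total α z.1 with h | h
      · exact Or.inl ⟨_, ⟨hzS, h⟩, rfl⟩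
      · exact Or.inr ⟨_, ⟨hzS, h⟩, rfl⟩)
    (by
      obtain ⟨z, hzS⟩ := hex 0 ⟨le_rfl, hμ.le⟩
      exact ⟨0, ⟨le_rfl, hμ.le⟩, _, ⟨hzS, hzS.2.1.1⟩, rfl⟩)
    (by
      obtain ⟨z, hzS⟩ := hex μ ⟨hμ.le, le_rfl⟩
      exact ⟨μ, ⟨hμ.le, le_rfl⟩, _, ⟨hzS, (hnd _ hzS.1 _ hzS.2.1 hzS.2.2).2.2.2.2⟩, rfl⟩)
  dsimp only at h hα hzα hzα'
  subst h
  obtain ⟨n1, n2, n3, n4, -⟩ := hnd _ hzS.1 _ hzS.2.1 hzS.2.2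
  obtain ⟨n1', n2', n3', n4', -⟩ := hnd _ hzS'.1 _ hzS'.2.1 hzS'.2.2
  have heq := lower_atom_unique (strictConcaveOn_senderValue_left hcc hκ)
    (strictConcaveOn_senderValue_right hcc hκ (by linarith [hα.1])) hz hzS.2.1 hzS'.2.1
    hzS.2.2 hzS'.2.2 n3 n1 n2 n3' n1' n2'
  exact n4 (le_antisymm (heq.le.trans hzα') hzα)

end FiniteDimensional

section Measures

variable {Q : Measure ℝ}

theorem integrable_of_continuous_of_unitInterval [IsFiniteMeasure Q] (hQ : Q (Icc (0:ℝ) 1)ᶜ = 0)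
    {φ : ℝ → ℝ} (hφ : Continuous φ) : Integrable φ Q := by
  have h : Q.restrict (Icc 0 1) = Q := Measure.restrict_eq_self_of_ae_mem hQ
  rw [← h]
  exact hφ.continuousOn.integrableOn_compact isCompact_Icc

/-- Jensen's inequality for the unnormalized conditional mean on a measurable set. -/
theorem exists_conditional_mean [IsFiniteMeasure Q] (hQ : Q (Icc (0:ℝ) 1)ᶜ = 0) {A : Set ℝ}
    (hA : MeasurableSet A) {l u : ℝ} (hlu : l ≤ u) (hsub : A ∩ Icc 0 1 ⊆ Icc l u) :
    ∃ m ∈ Icc l u, Q.real A * m = ∫ t in A, t ∂Q ∧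
      ∀ φ : ℝ → ℝ, Continuous φ → ConvexOn ℝ (Icc l u) φ →
        Q.real A * φ m ≤ ∫ t in A, φ t ∂Q := by
  have hae : ∀ᵐ t ∂Q.restrict A, t ∈ Icc l u := by
    rw [ae_restrict_iff' hA]
    filter_upwards [show ∀ᵐ t ∂Q, t ∈ Icc (0:ℝ) 1 from hQ] with t ht htA using hsub ⟨htA, ht⟩
  by_cases h0 : Q A = 0
  · refine ⟨l, ⟨le_rfl, hlu⟩, ?_, fun φ _ _ => ?_⟩ <;>
      simp [Measure.real, h0, Measure.restrict_eq_zero.2 h0]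
  have hpos : 0 < Q.real A := ENNReal.toReal_pos h0 (measure_ne_top Q A)
  have hid : IntegrableOn (fun t : ℝ => t) A Q :=
    (integrable_of_continuous_of_unitInterval hQ continuous_id).integrableOn
  refine ⟨⨍ t in A, t ∂Q, ?_, ?_, fun φ hφ hconv => ?_⟩
  · exact (convex_Icc l u).set_average_mem isClosed_Icc h0 (measure_ne_top Q A) hae hid
  · rw [setAverage_eq, smul_eq_mul, mul_inv_cancel_left₀ hpos.ne']
  · have h := hconv.map_set_average_le hφ.continuousOn isClosed_Icc h0 (measure_ne_top Q A) hae hid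
      (integrable_of_continuous_of_unitInterval hQ hφ).integrableOn
    rw [setAverage_eq Q (fun t => φ t), smul_eq_mul] at h
    calc _ ≤ Q.real A * ((Q.real A)⁻¹ * ∫ t in A, φ t ∂Q) := by gcongr
      _ = _ := mul_inv_cancel_left₀ hpos.ne' _

theorem integral_mcdf [IsFiniteMeasure Q] (hQ : Q (Icc (0:ℝ) 1)ᶜ = 0) {x : ℝ} (hx : 0 ≤ x) :
    ∫ s in (0:ℝ)..x, mcdf Q s = ∫ t, max (x - t) 0 ∂Q := by
  have h1 : ∀ s, mcdf Q s = ∫ t, (Ici t).indicator (fun _ => (1:ℝ)) s ∂Q := fun s => by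
    have : (fun t : ℝ => (Ici t).indicator (fun _ => (1:ℝ)) s) = (Iic s).indicator 1 := by
      ext t
      simp [indicator_apply]
    rw [this, integral_indicator_one measurableSet_Iic]
    rfl
  simp_rw [h1]
  rw [intervalIntegral_integral_swap]
  · refine integral_congr_ae ?_
    filter_upwards [show ∀ᵐ t ∂Q, t ∈ Icc (0:ℝ) 1 from hQ] with t ht
    rw [intervalIntegral.integral_of_le hx, integral_indicator_const _ measurableSet_Ici,
      smul_eq_mul, mul_one, Measure.real, Measure.restrict_apply measurableSet_Ici]
    rw [show Ici t ∩ Ioc 0 x = (Icc t x) \ {0} by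
      ext s
      simp only [mem_inter_iff, mem_Ici, mem_Ioc, mem_sdiff, mem_Icc, mem_singleton_iff]
      constructor
      · rintro ⟨h, h', h''⟩
        exact ⟨⟨h, h''⟩, h'.ne'⟩
      · rintro ⟨⟨h, h'⟩, h''⟩
        exact ⟨h, lt_of_le_of_ne (ht.1.trans h) (Ne.symm h''), h'⟩]
    rw [measure_sdiff_null (by simp), Real.volume_Icc, ENNReal.toReal_ofReal']
  · have : IsFiniteMeasure (volume.restrict (uIoc 0 x)) :=
      isFiniteMeasure_restrict.2 measure_Ioc_lt_top.ne
    refine Integrable.of_bound (C := 1) ?_ (Filter.Eventually.of_forall fun q => ?_)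
    · refine Measurable.aestronglyMeasurable ?_
      have : Function.uncurry (fun s t : ℝ => (Ici t).indicator (fun _ => (1:ℝ)) s) =
          {q : ℝ × ℝ | q.2 ≤ q.1}.indicator fun _ => 1 := by
        ext ⟨s, t⟩
        simp [indicator_apply]
      rw [this]
      exact measurable_const.indicator (measurableSet_le measurable_snd measurable_fst)
    · simp only [Function.uncurry, indicator_apply]
      split_ifs <;> simp

theorem integral_mcdf_one [IsProbabilityMeasure Q] (hQ : Q (Icc (0:ℝ) 1)ᶜ = 0) :
    ∫ s in (0:ℝ)..1, mcdf Q s = 1 - ∫ t, t ∂Q := by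
  rw [integral_mcdf hQ zero_le_one]
  have h : (fun t : ℝ => max (1 - t) 0) =ᵐ[Q] fun t => 1 - t := by
    filter_upwards [show ∀ᵐ t ∂Q, t ∈ Icc (0:ℝ) 1 from hQ] with t ht
    exact max_eq_left (by linarith [ht.2])
  rw [integral_congr_ae h, integral_sub (integrable_const _)
    (integrable_of_continuous_of_unitInterval hQ (φ := fun t => t) continuous_id)]
  simp

theorem integral_binaryMeasure {z : ℝ × ℝ × ℝ} (h0 : 0 ≤ z.2.2) (h1 : z.2.2 ≤ 1) (φ : ℝ → ℝ) :
    ∫ t, φ t ∂binaryMeasure z = binaryValue φ z := by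
  have hi : ∀ (r a : ℝ), Integrable φ (ENNReal.ofReal r • Measure.dirac a) := fun r a =>
    (integrable_dirac (by simp)).smul_measure ENNReal.ofReal_ne_top
  rw [binaryMeasure, integral_add_measure (hi _ _) (hi _ _), MeasureTheory.integral_smul_measure,
    MeasureTheory.integral_smul_measure, integral_dirac, integral_dirac, ENNReal.toReal_ofReal h0,
    ENNReal.toReal_ofReal (sub_nonneg.2 h1)]
  rfl

theorem memM_binaryMeasure {P : Measure ℝ} [IsProbabilityMeasure P]
    (hP : P (Icc (0:ℝ) 1)ᶜ = 0) {μ : ℝ} (hμ : ∫ t, t ∂P = μ) {z : ℝ × ℝ × ℝ}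
    (hz : z ∈ binaryContractions (fun x => ∫ s in (0:ℝ)..x, mcdf P s) μ) :
    MemM P (binaryMeasure z) := by
  obtain ⟨h1, h2, h3, h4, h5, h6, h7⟩ := hz
  have hprob : IsProbabilityMeasure (binaryMeasure z) := ⟨by
    simp only [binaryMeasure, Measure.add_apply, Measure.smul_apply, measure_univ, smul_eq_mul,
      mul_one]
    rw [← ENNReal.ofReal_add h4 (sub_nonneg.2 h5)]
    simp⟩
  have hsupp : binaryMeasure z (Icc (0:ℝ) 1)ᶜ = 0 := by
    have ha : z.1 ∈ Icc (0:ℝ) 1 := ⟨h1, h2.trans h3⟩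
    have hb : z.2.1 ∈ Icc (0:ℝ) 1 := ⟨h1.trans h2, h3⟩
    simp only [binaryMeasure, Measure.add_apply, Measure.smul_apply, smul_eq_mul,
      Measure.dirac_apply' _ measurableSet_Icc.compl, indicator_apply, mem_compl_iff, ha, hb,
      not_true_eq_false, if_false, mul_zero, add_zero]
  refine ⟨hprob, hsupp, fun x hx => ?_, ?_⟩
  · rw [integral_mcdf hsupp hx.1, integral_binaryMeasure h4 h5]
    exact h7 x hx
  · rw [integral_mcdf_one hsupp, integral_mcdf_one hP, integral_binaryMeasure h4 h5, hμ]
    exact congrArg _ h6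

/-- Pooling on both sides of the kink turns any contraction into a binary one of higher value. -/
theorem MemM.exists_binary_ge {P Q : Measure ℝ} [IsProbabilityMeasure P] (h : MemM P Q)
    (hP : P (Icc (0:ℝ) 1)ᶜ = 0) {μ : ℝ} (hμ : ∫ t, t ∂P = μ) {V : ℝ → ℝ} (hV : Continuous V)
    {m : ℝ} (hm : m ∈ Icc (0:ℝ) 1) (hl : ConcaveOn ℝ (Icc 0 m) V)
    (hr : ConcaveOn ℝ (Icc m 1) V) :
    ∃ z ∈ binaryContractions (fun x => ∫ s in (0:ℝ)..x, mcdf P s) μ,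
      ∫ x, V x ∂Q ≤ binaryValue V z := by
  obtain ⟨hprob, hQ, hle, heq⟩ := h
  obtain ⟨a, ha, hamean, haJ⟩ := exists_conditional_mean hQ (measurableSet_Iic (a := m)) hm.1
    fun t ht => ⟨ht.2.1, ht.1⟩
  obtain ⟨b, hb, hbmean, hbJ⟩ := exists_conditional_mean hQ (measurableSet_Iic (a := m)).compl hm.2
    fun t ht => ⟨le_of_not_ge ht.1, ht.2.2⟩
  rw [probReal_compl_eq_one_sub measurableSet_Iic] at hbmean hbJ
  have split : ∀ φ : ℝ → ℝ, Continuous φ →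
      (∫ t in Iic m, φ t ∂Q) + ∫ t in (Iic m)ᶜ, φ t ∂Q = ∫ t, φ t ∂Q := fun φ hφ =>
    integral_add_compl measurableSet_Iic (integrable_of_continuous_of_unitInterval hQ hφ)
  refine ⟨(a, b, Q.real (Iic m)), ⟨ha.1, ha.2.trans hb.1, hb.2, measureReal_nonneg,
    measureReal_le_one, ?_, fun x hx => ?_⟩, ?_⟩
  · rw [integral_mcdf_one hQ, integral_mcdf_one hP, hμ] at heq
    have := split (fun t => t) continuous_id
    dsimp only
    linarith
  · have hφ : Continuous fun t : ℝ => max (x - t) 0 := by fun_prop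
    have hconv : ∀ l u : ℝ, ConvexOn ℝ (Icc l u) fun t : ℝ => max (x - t) 0 := fun l u =>
      ((convexOn_const x (convex_Icc l u)).sub (concaveOn_id (convex_Icc l u))).sup
        (convexOn_const 0 (convex_Icc l u))
    refine le_trans ?_ (hle x hx)
    rw [integral_mcdf hQ hx.1, ← split _ hφ]
    exact add_le_add (haJ _ hφ (hconv _ _)) (hbJ _ hφ (hconv _ _))
  · have e1 := haJ _ hV.neg hl.neg
    have e2 := hbJ _ hV.neg hr.neg
    simp only [Pi.neg_apply, MeasureTheory.integral_neg, mul_neg] at e1 e2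
    rw [← split V hV]
    simp only [binaryValue]
    linarith

theorem dirac_mem_binaryContractions {P : Measure ℝ} [IsProbabilityMeasure P]
    (hP : P (Icc (0:ℝ) 1)ᶜ = 0) :
    (∫ t, t ∂P, ∫ t, t ∂P, 1) ∈
      binaryContractions (fun x => ∫ s in (0:ℝ)..x, mcdf P s) (∫ t, t ∂P) := by
  obtain ⟨m, hm, hmean, hJ⟩ := exists_conditional_mean hP MeasurableSet.univ zero_le_one
    inter_subset_right
  simp only [probReal_univ, one_mul, Measure.restrict_univ] at hmean hJ
  rw [← hmean]
  refine ⟨hm.1, le_rfl, hm.2, zero_le_one, le_rfl, by ring, fun x hx => ?_⟩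
  simp only [sub_self, zero_mul, one_mul, add_zero]
  rw [integral_mcdf hP hx.1]
  exact hJ _ (by fun_prop)
    (((convexOn_const x (convex_Icc 0 1)).sub (concaveOn_id (convex_Icc 0 1))).sup
      (convexOn_const 0 (convex_Icc 0 1)))

theorem msupport_binaryMeasure {z : ℝ × ℝ × ℝ} (h0 : 0 < z.2.2) (h1 : z.2.2 < 1) :
    msupport (binaryMeasure z) = {z.1, z.2.1} := by
  ext x
  simp only [msupport, mem_ofPred_eq, mem_insert_iff, mem_singleton_iff]
  constructor
  · intro h
    by_contra! hne
    have hU : ({z.1, z.2.1} : Set ℝ)ᶜ ∈ nhds x :=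
      (Set.toFinite _).isClosed.isOpen_compl.mem_nhds (by simp [hne.1, hne.2])
    refine h _ hU ?_
    simp [binaryMeasure]
  · rintro (rfl | rfl) U hU
    · simp [binaryMeasure, Measure.dirac_apply_of_mem (mem_of_mem_nhds hU), h0]
    · simp [binaryMeasure, Measure.dirac_apply_of_mem (mem_of_mem_nhds hU), h1]

theorem withDensity_unitInterval_compl (f : ℝ → ENNReal) :
    (volume.restrict (Icc (0:ℝ) 1)).withDensity f (Icc (0:ℝ) 1)ᶜ = 0 :=
  withDensity_absolutelyContinuous _ _ (by
    rw [Measure.restrict_apply measurableSet_Icc.compl]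
    simp)

theorem integral_id_withDensity_unitInterval {f : ℝ → ℝ} (hf : ContinuousOn f (Icc 0 1))
    (hpos : ∀ t ∈ Icc (0:ℝ) 1, 0 < f t) :
    ∫ t, t ∂(volume.restrict (Icc (0:ℝ) 1)).withDensity (fun t => ENNReal.ofReal (f t)) =
      ∫ t in (0:ℝ)..1, t * f t := by
  have hm : AEMeasurable (fun t => ENNReal.ofReal (f t)) (volume.restrict (Icc (0:ℝ) 1)) :=
    (hf.aemeasurable measurableSet_Icc).ennreal_ofReal
  rw [integral_withDensity_eq_integral_toReal_smul₀ hm (by simp),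
    intervalIntegral.integral_of_le zero_le_one, ← integral_Icc_eq_integral_Ioc]
  refine setIntegral_congr_fun measurableSet_Icc fun t ht => ?_
  simp only [smul_eq_mul, ENNReal.toReal_ofReal (hpos t ht).le, mul_comm]

end Measures

/-- Fix `γ > 0` and `κ > 0`.  There exist a conjectured
non-certification value `α ∈ [0,μ]` and a maximizer `Q ∈ 𝓜(F)` of `∫ V_α dQ`
such that either `Q = δ_μ`, or the support of `Q` consists of exactly two points
whose minimum is `α`.  (Such a fixed point need not be unique.) -/
theorem equilibrium_fixed_point_exists
    (f : ℝ → ℝ) (P : Measure ℝ)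
    (hf_cont : ContinuousOn f (Icc 0 1))
    (hf_pos : ∀ t ∈ Icc (0:ℝ) 1, 0 < f t)
    (hP : P = (volume.restrict (Icc (0:ℝ) 1)).withDensity fun t => ENNReal.ofReal (f t))
    (hPprob : IsProbabilityMeasure P)
    (μ : ℝ) (hμdef : μ = ∫ t in (0:ℝ)..1, t * f t) (hμ : μ ∈ Ioo (0:ℝ) 1)
    (hlog : StrictConcaveOn ℝ (Ioc (0:ℝ) 1) fun x => Real.log (∫ t in (0:ℝ)..x, f t))
    (c : ℝ → ℝ) (hc : ContDiff ℝ 2 c) (hcconv : StrictConvexOn ℝ (Icc 0 1) c)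
    (hcμ : c μ = 0)
    (κ γ : ℝ) (hκ : 0 < κ) (hγ : 0 < γ) :
    ∃ α ∈ Icc (0:ℝ) μ, ∃ Q : Measure ℝ, MemM P Q ∧
      (∀ Q' : Measure ℝ, MemM P Q' →
        (∫ x, (max α (x - γ) - κ * c x) ∂Q') ≤ ∫ x, (max α (x - γ) - κ * c x) ∂Q) ∧
      (Q = Measure.dirac μ ∨
        ∃ a b : ℝ, a ≠ b ∧ msupport Q = {a, b} ∧ sInf (msupport Q) = α) := by
  have hP0 : P (Icc (0:ℝ) 1)ᶜ = 0 := hP ▸ withDensity_unitInterval_compl _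
  have hmean : ∫ t, t ∂P = μ := by
    rw [hμdef, hP, integral_id_withDensity_unitInterval hf_cont hf_pos]
  have hdirac := dirac_mem_binaryContractions hP0
  rw [hmean] at hdirac
  obtain ⟨α, hα, z, hz, hmax, hfix⟩ :=
    exists_binary_fixed_point hc.continuous hcconv hκ hγ hμ.1 hdirac
  have hV : Continuous (senderValue c κ γ α) := by
    have := hc.continuous
    unfold senderValue
    fun_prop
  have hk : 0 ≤ α + γ := by linarith [hα.1]
  refine ⟨α, hα, binaryMeasure z, memM_binaryMeasure hP0 hmean hz, fun Q' hQ' => ?_, ?_⟩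
  · obtain ⟨w, hw, hle⟩ := hQ'.exists_binary_ge hP0 hmean hV
      ⟨le_min hk zero_le_one, min_le_right _ _⟩
      (strictConcaveOn_senderValue_left hcconv hκ).concaveOn
      (strictConcaveOn_senderValue_right hcconv hκ hk).concaveOn
    have h := integral_binaryMeasure hz.2.2.2.1 hz.2.2.2.2.1 (senderValue c κ γ α)
    exact (hle.trans (hmax w hw)).trans h.ge
  · rcases hfix with rfl | ⟨h0, h1, hlt, ha⟩
    · left
      simp [binaryMeasure]
    · right
      have hsupp := msupport_binaryMeasure h0 h1
      refine ⟨z.1, z.2.1, hlt.ne, hsupp, ?_⟩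
      rw [hsupp, csInf_pair, inf_eq_left.2 hlt.le, ha]
end

section
/- Let 0 < γ < 1 − μ and for κ > 0 define τ_κ(x) := κ c'(μ)(μ − x) + μ − x + γ + κ c(x). Then there exists κ̄ > 0 such that for every κ ≥ κ̄ and every x ∈ [μ+γ, 1], τ_κ(x) > 0; in particular, for all κ sufficiently large, τ_κ has no root in [μ+γ, 1]. -/
open Set

/-- A strictly convex function lies strictly above its tangent line to the right of the
point of tangency. -/
theorem StrictConvexOn.tangent_lt_of_lt {s : Set ℝ} {f : ℝ → ℝ} {a x : ℝ}
    (hf : StrictConvexOn ℝ s f) (ha : a ∈ s) (hx : x ∈ s) (hax : a < x)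
    (hd : DifferentiableAt ℝ f a) : f a + deriv f a * (x - a) < f x := by
  have h := hf.lt_slope_of_hasDerivAt ha hx hax hd.hasDerivAt
  rw [slope_def_field, lt_div_iff₀ (sub_pos.2 hax)] at h
  linarith

/-- Let `0 < γ < 1 - μ` and `τ_κ x = κ c'(μ)(μ - x) + μ - x + γ + κ c x`.
For all sufficiently large `κ`, `τ_κ` is strictly positive on `[μ+γ, 1]`, hence has
no root there. -/
theorem tau_pos_for_large_kappa
    (μ γ : ℝ) (hμ : μ ∈ Ioo (0:ℝ) 1) (hγ : 0 < γ) (hγ' : γ < 1 - μ)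
    (c : ℝ → ℝ) (hc : ContDiff ℝ 2 c) (hcconv : StrictConvexOn ℝ (Icc 0 1) c)
    (hcμ : c μ = 0) :
    ∃ κbar : ℝ, 0 < κbar ∧ ∀ κ : ℝ, κbar ≤ κ →
      ∀ x ∈ Icc (μ + γ) 1, 0 < κ * deriv c μ * (μ - x) + μ - x + γ + κ * c x := by
  have hcont : Continuous c := hc.continuous
  have hdiff : DifferentiableAt ℝ c μ := (hc.differentiable (by norm_num)).differentiableAt
  obtain ⟨hμ0, hμ1⟩ := hμ
  have hgap : ∀ x ∈ Icc (μ + γ) 1, 0 < c x - deriv c μ * (x - μ) := by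
    rintro x ⟨hx, hx1⟩
    have := hcconv.tangent_lt_of_lt ⟨hμ0.le, hμ1.le⟩ ⟨by linarith, hx1⟩ (by linarith) hdiff
    linarith
  obtain ⟨y, hy, hmin⟩ := isCompact_Icc.exists_isMinOn
    (nonempty_Icc.2 (by linarith : μ + γ ≤ 1))
    (by fun_prop : ContinuousOn (fun x => c x - deriv c μ * (x - μ)) (Icc (μ + γ) 1))
  have hm := hgap y hy
  refine ⟨1 / (c y - deriv c μ * (y - μ)), by positivity, fun κ hκ x hx => ?_⟩
  have hκm := (div_le_iff₀ hm).1 hκ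
  have hκ0 : 0 ≤ κ := le_trans (by positivity) hκ
  have hle := mul_le_mul_of_nonneg_left (isMinOn_iff.1 hmin x hx) hκ0
  linarith [hx.2]
end

section
/- Let γ > 0 and α ∈ [0, μ) with α + γ < μ, and for κ > 0 define ψ_κ(x) := (1 − κ c'(μ))(x − μ) + μ − γ − α + κ c(x). Then there exists κ̄ > 0 such that for every κ ≥ κ̄ and every x ∈ [0, α+γ], ψ_κ(x) > 0; in particular, for all κ sufficiently large, ψ_κ has no root in [0, α+γ]. -/
open Set

/-- Let `γ > 0`, `α ∈ [0,μ)` with `α + γ < μ`, and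
`ψ_κ x = (1 - κ c'(μ))(x - μ) + μ - γ - α + κ c x`.  For all sufficiently large `κ`,
`ψ_κ` is strictly positive on `[0, α+γ]`, hence has no root there. -/
theorem psi_pos_for_large_kappa
    (μ γ α : ℝ) (hμ : μ ∈ Ioo (0:ℝ) 1) (hγ : 0 < γ)
    (hα : α ∈ Ico (0:ℝ) μ) (hαγ : α + γ < μ)
    (c : ℝ → ℝ) (hc : ContDiff ℝ 2 c) (hcconv : StrictConvexOn ℝ (Icc 0 1) c)
    (hcμ : c μ = 0) :
    ∃ κbar : ℝ, 0 < κbar ∧ ∀ κ : ℝ, κbar ≤ κ →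
      ∀ x ∈ Icc (0:ℝ) (α + γ), 0 < (1 - κ * deriv c μ) * (x - μ) + μ - γ - α + κ * c x := by
  have hcont : Continuous fun x => c x - deriv c μ * (x - μ) := by
    have := hc.continuous
    fun_prop
  have hgap : ∀ x ∈ Icc (0:ℝ) (α + γ), 0 < c x - deriv c μ * (x - μ) := by
    intro x hx
    have hxμ : x < μ := hx.2.trans_lt hαγ
    have hslope : slope c x μ < deriv c μ :=
      hcconv.slope_lt_deriv ⟨hx.1, hxμ.le.trans hμ.2.le⟩ ⟨hμ.1.le, hμ.2.le⟩ hxμ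
        (hc.differentiable (by norm_num) μ)
    rw [slope_def_field, div_lt_iff₀ (sub_pos.2 hxμ), hcμ] at hslope
    linarith
  obtain ⟨x₀, hx₀, hmin⟩ := isCompact_Icc.exists_isMinOn
    (nonempty_Icc.2 (add_nonneg hα.1 hγ.le)) hcont.continuousOn
  set m := c x₀ - deriv c μ * (x₀ - μ)
  have hm_pos : 0 < m := hgap x₀ hx₀
  have hα0 : 0 ≤ α := hα.1
  refine ⟨(α + γ + 1) / m, by positivity, fun κ hκ x hx => ?_⟩
  have hκ_pos : 0 < κ := lt_of_lt_of_le (by positivity) hκ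
  have hle : m ≤ c x - deriv c μ * (x - μ) := hmin hx
  have hκm : α + γ + 1 ≤ κ * m := (div_le_iff₀ hm_pos).1 hκ
  have hκx := mul_le_mul_of_nonneg_left hle hκ_pos.le
  linarith [hx.1]
end

section
/- Let 0 < γ < 1 − μ and for κ > 0 define τ_κ(x) := κ c'(μ)(μ − x) + μ − x + γ + κ c(x). Then there exists κ₀ > 0 such that for every κ ∈ (0, κ₀] there exists x ∈ (μ+γ, 1) with τ_κ(x) = 0. -/
open Set

/-- Let `0 < γ < 1 - μ` and `τ_κ x = κ c'(μ)(μ - x) + μ - x + γ + κ c x`.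
For all sufficiently small `κ > 0`, `τ_κ` has a root in `(μ+γ, 1)`. -/
theorem tau_root_for_small_kappa
    (μ γ : ℝ) (hμ : μ ∈ Ioo (0:ℝ) 1) (hγ : 0 < γ) (hγ' : γ < 1 - μ)
    (c : ℝ → ℝ) (hc : ContDiff ℝ 2 c) (hcconv : StrictConvexOn ℝ (Icc 0 1) c)
    (hcμ : c μ = 0) :
    ∃ κ₀ : ℝ, 0 < κ₀ ∧ ∀ κ ∈ Ioc (0:ℝ) κ₀,
      ∃ x ∈ Ioo (μ + γ) 1, κ * deriv c μ * (μ - x) + μ - x + γ + κ * c x = 0 := by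
  obtain ⟨hμ0, hμ1⟩ := hμ
  have hdiff : Differentiable ℝ c := hc.differentiable (by norm_num)
  have hgap : γ * deriv c μ < c (μ + γ) := by
    have hslope := hcconv.deriv_lt_slope (x := μ) (y := μ + γ)
      ⟨hμ0.le, hμ1.le⟩ ⟨by linarith, by linarith⟩ (by linarith) (hdiff μ)
    rw [slope_def_field, hcμ, add_sub_cancel_left, sub_zero, lt_div_iff₀ hγ] at hslope
    linarith
  set A := deriv c μ * (μ - 1) + c 1 with hA
  have hden : 0 < |A| + 1 := by positivity
  refine ⟨(1 - μ - γ) / (2 * (|A| + 1)), div_pos (by linarith) (by positivity), ?_⟩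
  rintro κ ⟨hκ0, hκ⟩
  rw [le_div_iff₀ (by positivity)] at hκ
  have hcont : ContinuousOn
      (fun x => κ * deriv c μ * (μ - x) + μ - x + γ + κ * c x) (Icc (μ + γ) 1) := by
    have := hdiff.continuous
    fun_prop
  have hleft : 0 < κ * (c (μ + γ) - γ * deriv c μ) := mul_pos hκ0 (by linarith)
  have hright : κ * A ≤ κ * |A| := mul_le_mul_of_nonneg_left (le_abs_self A) hκ0.le
  exact intermediate_value_Ioo' (by linarith) hcont ⟨by nlinarith, by nlinarith⟩
end

section
/- Let 0 < γ < μ and for κ > 0 define ψ⁰_κ(x) := (1 − κ c'(μ))(x − μ) + μ − γ + κ c(x). Then there exists κ₀ > 0 such that for every κ ∈ (0, κ₀] there exists x ∈ (0, γ) with ψ⁰_κ(x) = 0. -/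
open Set

/-- Let `0 < γ < μ` and `ψ⁰_κ x = (1 - κ c'(μ))(x - μ) + μ - γ + κ c x`.
For all sufficiently small `κ > 0`, `ψ⁰_κ` has a root in `(0, γ)`. -/
theorem psi_zero_root_for_small_kappa
    (μ γ : ℝ) (hμ : μ ∈ Ioo (0:ℝ) 1) (hγ : 0 < γ) (hγ' : γ < μ)
    (c : ℝ → ℝ) (hc : ContDiff ℝ 2 c) (hcconv : StrictConvexOn ℝ (Icc 0 1) c)
    (hcμ : c μ = 0) :
    ∃ κ₀ : ℝ, 0 < κ₀ ∧ ∀ κ ∈ Ioc (0:ℝ) κ₀,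
      ∃ x ∈ Ioo (0:ℝ) γ, (1 - κ * deriv c μ) * (x - μ) + μ - γ + κ * c x = 0 := by
  have hslope := hcconv.slope_lt_deriv (x := γ) (y := μ)
    ⟨hγ.le, (hγ'.trans hμ.2).le⟩ ⟨hμ.1.le, hμ.2.le⟩ hγ'
    (hc.differentiable (by norm_num) μ)
  rw [slope_def_field, div_lt_iff₀ (sub_pos.2 hγ'), hcμ] at hslope
  set A := |c 0 + deriv c μ * μ| with hA
  have hA0 : 0 ≤ A := abs_nonneg _
  refine ⟨γ / (A + 1), by positivity, fun κ ⟨hκ, hκle⟩ => ?_⟩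
  rw [le_div_iff₀ (by positivity)] at hκle
  have hcont : Continuous c := hc.continuous
  have hψ : ContinuousOn
      (fun x => (1 - κ * deriv c μ) * (x - μ) + μ - γ + κ * c x) (Icc 0 γ) := by
    fun_prop
  refine intermediate_value_Ioo hγ.le hψ ⟨?_, ?_⟩
  · have := mul_le_mul_of_nonneg_left (le_abs_self (c 0 + deriv c μ * μ)) hκ.le
    rw [← hA] at this
    linarith
  · have := mul_lt_mul_of_pos_left hslope hκ
    linarith
end

section
/- Suppose the certification cost is γ = 0, so that with conjectured non-certification value μ the sender's value function is W(x) := max(μ, x) − κ c(x), which has a convex kink at x = μ. Then for every κ > 0 there exists Q ∈ M(F) with ∫₀¹ W(x) dQ(x) > μ; consequently, the point mass δ_μ (which yields value W(μ) = μ) does not maximize ∫₀¹ W dQ over Q ∈ M(F). -/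
open MeasureTheory Set intervalIntegral

/-- The cumulative distribution function is monotone. -/
lemma mcdf_mono (Q : Measure ℝ) [IsFiniteMeasure Q] : Monotone (mcdf Q) := fun _ _ h =>
  ENNReal.toReal_mono (measure_ne_top _ _) (measure_mono (Iic_subset_Iic.2 h))

lemma mcdf_nonneg (Q : Measure ℝ) (s : ℝ) : 0 ≤ mcdf Q s := ENNReal.toReal_nonneg

lemma mcdf_le_one (Q : Measure ℝ) [IsProbabilityMeasure Q] (s : ℝ) : mcdf Q s ≤ 1 :=
  measureReal_le_one (μ := Q)

lemma intervalIntegrable_mcdf (Q : Measure ℝ) [IsFiniteMeasure Q] (a b : ℝ) :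
    IntervalIntegrable (mcdf Q) volume a b :=
  (mcdf_mono Q).intervalIntegrable

/-- For a probability measure on `[0,1]`, the integral of the cumulative distribution function
is one minus the mean. -/
lemma integral_mcdf_eq_one_sub_mean (Q : Measure ℝ) [IsProbabilityMeasure Q]
    (hQ : Q (Icc (0:ℝ) 1)ᶜ = 0) : (∫ s in (0:ℝ)..1, mcdf Q s) = 1 - ∫ x, x ∂Q := by
  have hmem : ∀ᵐ x ∂Q, x ∈ Icc (0:ℝ) 1 := mem_ae_iff.2 hQ
  have hint : Integrable (fun x : ℝ => x) Q := by
    refine Integrable.of_bound measurable_id.aestronglyMeasurable 1 ?_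
    filter_upwards [hmem] with x hx
    rw [Real.norm_eq_abs, abs_of_nonneg hx.1]
    exact hx.2
  have hlc := hint.integral_eq_integral_meas_lt (hmem.mono fun x hx => hx.1)
  have hIoi : ∀ t, Q.real {a | t < a} = 1 - mcdf Q t := fun t => by
    have := probReal_compl_eq_one_sub (μ := Q) (measurableSet_Iic (a := t))
    rwa [compl_Iic] at this
  have htail : ∀ t ∈ Ioi (0:ℝ) \ Ioc 0 1, Q.real {a | t < a} = 0 := by
    intro t ht
    have h1 : 1 < t := by
      by_contra! h
      exact ht.2 ⟨ht.1, h⟩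
    refine (measureReal_eq_zero_iff (μ := Q)).2 (measure_mono_null ?_ hQ)
    intro x hx hx'
    have hx : t < x := hx
    linarith [hx'.2]
  rw [setIntegral_eq_of_subset_of_forall_sdiff_eq_zero measurableSet_Ioi
    Ioc_subset_Ioi_self htail, ← intervalIntegral.integral_of_le zero_le_one] at hlc
  simp only [hIoi] at hlc
  rw [intervalIntegral.integral_sub (by simp) (intervalIntegrable_mcdf Q 0 1)] at hlc
  simp only [intervalIntegral.integral_const, sub_zero, smul_eq_mul, mul_one] at hlc
  linarith

/-- A probability measure with the same mean as `P`, concentrated on an interval `(a, b]` whose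
length is at most the integral over `[0, a]` of the cumulative distribution function of `P`, is a
mean-preserving contraction of `P`. -/
lemma memM_of_concentrated (P Q : Measure ℝ) [IsProbabilityMeasure P] [IsProbabilityMeasure Q]
    (hP : P (Icc (0:ℝ) 1)ᶜ = 0) {a b : ℝ} (ha : 0 ≤ a) (hb : b ≤ 1)
    (hQ : Q (Ioc a b)ᶜ = 0) (hmean : ∫ x, x ∂Q = ∫ x, x ∂P)
    (hlen : b - a ≤ ∫ s in (0:ℝ)..a, mcdf P s) : MemM P Q := by
  have hQ01 : Q (Icc (0:ℝ) 1)ᶜ = 0 :=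
    measure_mono_null (compl_subset_compl.2 fun x hx =>
      ⟨ha.trans hx.1.le, hx.2.trans hb⟩) hQ
  have hQI := integral_mcdf_eq_one_sub_mean Q hQ01
  have hPI := integral_mcdf_eq_one_sub_mean P hP
  have hlow : ∀ s ≤ a, mcdf Q s = 0 := fun s hs => by
    refine (measureReal_eq_zero_iff (μ := Q)).2 (measure_mono_null ?_ hQ)
    intro x hx hx'
    have hx : x ≤ s := hx
    linarith [hx'.1]
  have hhigh : ∀ s, b ≤ s → mcdf Q s = 1 := fun s hs => by
    have h : Q (Iic s)ᶜ = 0 :=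
      measure_mono_null (compl_subset_compl.2 fun x hx => hx.2.trans hs) hQ
    rw [mcdf, (prob_compl_eq_zero_iff measurableSet_Iic).1 h, ENNReal.toReal_one]
  have hlowI : ∀ x, 0 ≤ x → x ≤ a → (∫ s in (0:ℝ)..x, mcdf Q s) = 0 := fun x h0 hx => by
    rw [intervalIntegral.integral_congr (g := fun _ => (0:ℝ)), intervalIntegral.integral_zero]
    intro s hs
    rw [uIcc_of_le h0] at hs
    exact hlow s (hs.2.trans hx)
  have hsplit : ∀ (R : Measure ℝ) [IsProbabilityMeasure R] (x y z : ℝ),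
      (∫ s in x..y, mcdf R s) + (∫ s in y..z, mcdf R s) = ∫ s in x..z, mcdf R s :=
    fun R _ x y z => intervalIntegral.integral_add_adjacent_intervals
      (intervalIntegrable_mcdf R x y) (intervalIntegrable_mcdf R y z)
  have hle : ∀ (R : Measure ℝ) [IsProbabilityMeasure R] (x y : ℝ), x ≤ y →
      (∫ s in x..y, mcdf R s) ≤ y - x := fun R _ x y hxy => by
    simpa using intervalIntegral.integral_mono_on hxy (intervalIntegrable_mcdf R x y)
      (intervalIntegrable_const (c := (1:ℝ))) (fun s _ => mcdf_le_one R s)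
  have hnn : ∀ (x y : ℝ), x ≤ y → 0 ≤ ∫ s in x..y, mcdf P s := fun x y hxy =>
    intervalIntegral.integral_nonneg hxy fun s _ => mcdf_nonneg P s
  refine ⟨inferInstance, hQ01, fun x hx => ?_, by rw [hQI, hPI, hmean]⟩
  rcases le_total x a with hxa | hxa
  · rw [hlowI x hx.1 hxa]
    exact hnn 0 x hx.1
  rcases le_total x b with hxb | hxb
  · have h1 := hsplit Q 0 a x
    have h2 := hsplit P 0 a x
    linarith [hlowI a ha le_rfl, hle Q a x hxa, hnn a x hxa]
  · have h1 := hsplit Q 0 x 1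
    have h2 := hsplit P 0 x 1
    have h3 : (∫ s in x..1, mcdf Q s) = 1 - x := by
      rw [intervalIntegral.integral_congr (g := fun _ => (1:ℝ))]
      · simp
      · intro s hs
        rw [uIcc_of_le hx.2] at hs
        exact hhigh s (hxb.trans hs.1)
    rw [hmean] at hQI
    linarith [hle P x 1 hx.2]

/-- The two-point measure placing mass one half on each of `x` and `y`. -/
noncomputable def halfHalf (x y : ℝ) : Measure ℝ :=
  (2⁻¹ : ENNReal) • Measure.dirac x + (2⁻¹ : ENNReal) • Measure.dirac y

instance isProbabilityMeasure_halfHalf (x y : ℝ) : IsProbabilityMeasure (halfHalf x y) :=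
  ⟨by simp [halfHalf, ENNReal.inv_two_add_inv_two]⟩

lemma integral_halfHalf (x y : ℝ) (g : ℝ → ℝ) :
    ∫ t, g t ∂(halfHalf x y) = (g x + g y) / 2 := by
  have hi : ∀ z, Integrable g ((2⁻¹ : ENNReal) • Measure.dirac z) := fun z =>
    (integrable_dirac (by simp)).smul_measure (by simp)
  rw [halfHalf, integral_add_measure (hi x) (hi y), MeasureTheory.integral_smul_measure,
    MeasureTheory.integral_smul_measure,
    integral_dirac, integral_dirac]
  simp
  ring

lemma halfHalf_compl_eq_zero {x y : ℝ} {s : Set ℝ} (hs : MeasurableSet s) (hx : x ∈ s)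
    (hy : y ∈ s) : halfHalf x y sᶜ = 0 := by
  simp [halfHalf, hs.compl, hx, hy]

/-- With certification cost `γ = 0` and conjectured non-certification
value `μ`, the sender's value function is `W x = max μ x - κ c x`.  For every `κ > 0`
there is `Q ∈ 𝓜(F)` with `∫ W dQ > μ`; consequently the point mass `δ_μ`, which yields
`W μ = μ`, does not maximize `∫ W dQ` over `𝓜(F)`. -/
theorem no_learning_not_optimal_when_certification_free
    (f : ℝ → ℝ) (P : Measure ℝ)
    (hf_cont : ContinuousOn f (Icc 0 1))
    (hf_pos : ∀ t ∈ Icc (0:ℝ) 1, 0 < f t)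
    (hP : P = (volume.restrict (Icc (0:ℝ) 1)).withDensity fun t => ENNReal.ofReal (f t))
    (hPprob : IsProbabilityMeasure P)
    (μ : ℝ) (hμdef : μ = ∫ t in (0:ℝ)..1, t * f t) (hμ : μ ∈ Ioo (0:ℝ) 1)
    (c : ℝ → ℝ) (hc : ContDiff ℝ 2 c) (hcconv : StrictConvexOn ℝ (Icc 0 1) c)
    (hcμ : c μ = 0)
    (κ : ℝ) (hκ : 0 < κ) :
    (∃ Q : Measure ℝ, MemM P Q ∧ μ < ∫ x, (max μ x - κ * c x) ∂Q) ∧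
      ¬ (∀ Q : Measure ℝ, MemM P Q →
        (∫ x, (max μ x - κ * c x) ∂Q) ≤ ∫ x, (max μ x - κ * c x) ∂(Measure.dirac μ)) := by
  have hfae : AEMeasurable (fun t => ENNReal.ofReal (f t)) (volume.restrict (Icc (0:ℝ) 1)) :=
    (hf_cont.aemeasurable measurableSet_Icc).ennreal_ofReal
  have hPc : P (Icc (0:ℝ) 1)ᶜ = 0 := by
    rw [hP]
    refine withDensity_absolutelyContinuous _ _ ?_
    rw [Measure.restrict_apply measurableSet_Icc.compl]
    simp
  have hPmean : ∫ x, x ∂P = μ := by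
    rw [hP, integral_withDensity_eq_integral_toReal_smul₀ hfae (by simp), hμdef,
      intervalIntegral.integral_of_le zero_le_one, ← integral_Icc_eq_integral_Ioc]
    refine setIntegral_congr_fun measurableSet_Icc fun t ht => ?_
    simp only [smul_eq_mul, ENNReal.toReal_ofReal (hf_pos t ht).le, mul_comm]
  obtain ⟨hμ0, hμ1⟩ := hμ
  have hFpos : 0 < mcdf P (μ / 4) := by
    refine ENNReal.toReal_pos (fun h => ?_) (measure_ne_top _ _)
    rw [hP, withDensity_apply_eq_zero' hfae,
      Measure.restrict_apply₀' measurableSet_Icc.nullMeasurableSet] at h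
    have hsub : Icc 0 (μ / 4) ⊆ {x | ENNReal.ofReal (f x) ≠ 0} ∩ Iic (μ / 4) ∩ Icc 0 1 := by
      intro x hx
      have hx1 : x ∈ Icc (0:ℝ) 1 := ⟨hx.1, by linarith [hx.2]⟩
      exact ⟨⟨(ENNReal.ofReal_pos.2 (hf_pos x hx1)).ne', hx.2⟩, hx1⟩
    have h0 := measure_mono_null hsub h
    rw [Real.volume_Icc, ENNReal.ofReal_eq_zero] at h0
    linarith
  have hIF : ∀ a, μ / 2 ≤ a → μ / 4 * mcdf P (μ / 4) ≤ ∫ s in (0:ℝ)..a, mcdf P s := by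
    intro a ha
    have h1 := intervalIntegral.integral_add_adjacent_intervals
      (intervalIntegrable_mcdf P 0 (μ / 4)) (intervalIntegrable_mcdf P (μ / 4) a)
    have h2 : 0 ≤ ∫ s in (0:ℝ)..(μ / 4), mcdf P s :=
      intervalIntegral.integral_nonneg (by linarith) fun s _ => mcdf_nonneg P s
    have h3 := intervalIntegral.integral_mono_on (by linarith : μ / 4 ≤ a)
      (intervalIntegrable_const (c := mcdf P (μ / 4))) (intervalIntegrable_mcdf P (μ / 4) a)
      (fun s hs => mcdf_mono P hs.1)
    rw [intervalIntegral.integral_const, smul_eq_mul] at h3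
    nlinarith
  have hd : HasDerivAt c (deriv c μ) μ :=
    (hc.differentiable (by norm_num) μ).hasDerivAt
  obtain ⟨r, hr, hball⟩ := Metric.eventually_nhds_iff.1
    ((hasDerivAt_iff_isLittleO.1 hd).def (by positivity : 0 < 1 / (4 * κ)))
  set δ := μ / 4 * mcdf P (μ / 4)
  have hδ : 0 < δ := by positivity
  obtain ⟨ε, hε, hεm⟩ : ∃ ε, 0 < ε ∧ ε < min (min r (δ / 3)) (min (μ / 4) (1 - μ)) :=
    exists_between (lt_min (lt_min hr (by linarith)) (lt_min (by linarith) (by linarith)))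
  simp only [lt_min_iff] at hεm
  obtain ⟨⟨hεr, hεδ⟩, hεμ, hε1⟩ := hεm
  have hQM : MemM P (halfHalf (μ - ε) (μ + ε)) := by
    refine memM_of_concentrated P _ hPc (a := μ - 2 * ε) (b := μ + ε) (by linarith)
      (by linarith) (halfHalf_compl_eq_zero measurableSet_Ioc
        ⟨by linarith, by linarith⟩ ⟨by linarith, le_rfl⟩) ?_ ?_
    · rw [integral_halfHalf _ _ fun x => x, hPmean]
      ring
    · linarith [hIF (μ - 2 * ε) (by linarith)]
  have hcm := hball (y := μ - ε) (by simpa [Real.dist_eq, abs_of_pos hε] using hεr)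
  have hcp := hball (y := μ + ε) (by simpa [Real.dist_eq, abs_of_pos hε] using hεr)
  simp only [hcμ, sub_zero, sub_sub_cancel_left, add_sub_cancel_left, smul_eq_mul, norm_neg,
    Real.norm_eq_abs, abs_of_pos hε] at hcm hcp
  have hcost : κ * (c (μ - ε) + c (μ + ε)) ≤ ε / 2 := by
    have h : c (μ - ε) + c (μ + ε) ≤ 2 * (1 / (4 * κ) * ε) := by
      linarith [(abs_le.1 hcm).2, (abs_le.1 hcp).2]
    calc κ * (c (μ - ε) + c (μ + ε)) ≤ κ * (2 * (1 / (4 * κ) * ε)) := by gcongr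
      _ = ε / 2 := by field_simp; norm_num
  have hval : μ < ∫ x, (max μ x - κ * c x) ∂(halfHalf (μ - ε) (μ + ε)) := by
    rw [integral_halfHalf, max_eq_left (by linarith : μ - ε ≤ μ),
      max_eq_right (by linarith : μ ≤ μ + ε)]
    linarith
  refine ⟨⟨_, hQM, hval⟩, fun h => ?_⟩
  have h' := h _ hQM
  rw [integral_dirac, max_self, hcμ] at h'
  linarith
end
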